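/- Let X₀ ⊆ Homeo₊(I) be a finite geometrically fast set with only finitely many transition points, equipped with a marking of its used bumps. Then there exists a geometrically fast set Y ⊆ PL₊(I) whose dynamical diagram is isomorphic to that of X₀ with the following property: for every geometrically fast X ⊆ Homeo₊(I) with finitely many transition points whose dynamical diagram is isomorphic to that of X₀ (via τ : X → Y), there exist a group isomorphism φ : ⟨X⟩ → ⟨Y⟩ extending τ and a continuous order-preserving surjection θ̂ : I → I such that (tf)θ̂ = (tθ̂)φ(f) for every t ∈ I and every f ∈ ⟨X⟩. -/

import Mathlib

open Set

/-- The unit interval `[0,1]` as a type. -/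
abbrev UI : Type := ↥unitInterval

/-- Bijections of the unit interval; orientation-preserving homeomorphisms are
exactly the monotone ones among these. -/
abbrev Homeo01 : Type := Equiv.Perm UI

namespace PingPong

/-- The support of `f`. -/
def supt (f : Homeo01) : Set UI := {t | f t ≠ t}

/-- `f` is an orientation-preserving homeomorphism of `[0,1]`:
a monotone bijection of `[0,1]` (automatically a homeomorphism). -/
def IsOPH (f : Homeo01) : Prop := Monotone ⇑f

/-- A bump function: an orientation preserving homeomorphism with exactly one
orbital, i.e. whose support is nonempty and connected. -/
def IsBump (f : Homeo01) : Prop := IsOPH f ∧ IsConnected (supt f)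

/-- A positive bump function. -/
def IsPosBump (f : Homeo01) : Prop := IsBump f ∧ ∀ t ∈ supt f, t < f t

/-- The source of a positive bump `a` with marker `t`. -/
def src (a : Homeo01) (t : UI) : Set UI := {s ∈ supt a | s < t}

/-- The destination of a positive bump `a` with marker `t`. -/
def dest (a : Homeo01) (t : UI) : Set UI := {s ∈ supt a | a t ≤ s}

/-- `m` is a marking of the collection `A` of bumps. -/
def IsMarking (A : Set Homeo01) (m : Homeo01 → UI) : Prop := ∀ a ∈ A, m a ∈ supt a

/-- The feet of a marked bump: `false` gives the source, `true` the destination. -/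
def foot (a : Homeo01) (t : UI) : Bool → Set UI
  | false => src a t
  | true => dest a t

/-- The feet of the marked family `(A, m)` are pairwise disjoint. -/
def FeetDisjoint (A : Set Homeo01) (m : Homeo01 → UI) : Prop :=
  ∀ a ∈ A, ∀ b ∈ A, ∀ i j : Bool, (a, i) ≠ (b, j) →
    Disjoint (foot a (m a) i) (foot b (m b) j)

/-- A geometrically fast collection of (positive) bumps. -/
def FastBumps (A : Set Homeo01) : Prop :=
  (∀ a ∈ A, IsPosBump a) ∧ ∃ m : Homeo01 → UI, IsMarking A m ∧ FeetDisjoint A m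

/-- `t` is a left transition point of `f`. -/
def IsLeftTransition (f : Homeo01) (t : UI) : Prop :=
  t ∉ supt f ∧ ∀ ε : ℝ, 0 < ε → ∃ s ∈ supt f, t < s ∧ (s : ℝ) < (t : ℝ) + ε

/-- `t` is a right transition point of `f`. -/
def IsRightTransition (f : Homeo01) (t : UI) : Prop :=
  t ∉ supt f ∧ ∀ ε : ℝ, 0 < ε → ∃ s ∈ supt f, s < t ∧ (t : ℝ) - ε < (s : ℝ)

/-- `t` is a transition point of `f`. -/
def IsTransition (f : Homeo01) (t : UI) : Prop :=
  IsLeftTransition f t ∨ IsRightTransition f t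

/-- A geometrically proper set of homeomorphisms. -/
def GeomProper (X : Set Homeo01) : Prop :=
  (∀ f ∈ X, ∀ g ∈ X, f ≠ g → ∀ t : UI, ¬(IsLeftTransition f t ∧ IsLeftTransition g t)) ∧
  (∀ f ∈ X, ∀ g ∈ X, f ≠ g → ∀ t : UI, ¬(IsRightTransition f t ∧ IsRightTransition g t))

/-- The positive bump `a` is used in `f`. -/
def UsedIn (f a : Homeo01) : Prop :=
  IsPosBump a ∧ (Set.EqOn ⇑f ⇑a (supt a) ∨ Set.EqOn ⇑f ⇑a⁻¹ (supt a))

/-- The set of (positive) bumps used in `X`. -/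
def usedBumps (X : Set Homeo01) : Set Homeo01 := {a | ∃ f ∈ X, UsedIn f a}

/-- A geometrically fast set of homeomorphisms. -/
def GeomFast (X : Set Homeo01) : Prop := GeomProper X ∧ FastBumps (usedBumps X)

/-- The set of transition points of elements of `X`. -/
def transitionPoints (X : Set Homeo01) : Set UI := {t | ∃ f ∈ X, IsTransition f t}

/-! ### Words -/

/-- A word in the alphabet `A^± = A ∪ A⁻¹`, recorded as a list of the permutations
represented by its symbols (for a set `A` of positive bumps this is faithful,
since `A ∩ A⁻¹ = ∅`). -/
def WordOn (A : Set Homeo01) (w : List Homeo01) : Prop := ∀ x ∈ w, x ∈ A ∨ x⁻¹ ∈ A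

/-- A freely reduced word: no symbol is immediately followed by its inverse. -/
def FreelyReduced (w : List Homeo01) : Prop := List.Chain' (fun a b => b ≠ a⁻¹) w

/-- The right action of a word on a point: apply the symbols from left to right. -/
def act (t : UI) (w : List Homeo01) : UI := w.foldl (fun s a => a s) t

/-- `w` is locally reduced at `t`. -/
def LocallyReducedAt (w : List Homeo01) (t : UI) : Prop :=
  FreelyReduced w ∧ ∀ (u : List Homeo01) (a : Homeo01), u ++ [a] <+: w → a (act t u) ≠ act t u

open Classical in
/-- The source of a symbol of `A^±`: for `a ∈ A` it is `src a`, and for the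
formal inverse of an element of `A` it is the destination of that element. -/
noncomputable def symSrc (A : Set Homeo01) (m : Homeo01 → UI) (b : Homeo01) : Set UI :=
  if b ∈ A then src b (m b) else dest b⁻¹ (m b⁻¹)

open Classical in
/-- The destination of a symbol of `A^±`. -/
noncomputable def symDest (A : Set Homeo01) (m : Homeo01 → UI) (b : Homeo01) : Set UI :=
  if b ∈ A then dest b (m b) else src b⁻¹ (m b⁻¹)

/-- The source of a word: the source of its first symbol (empty for the empty word). -/
noncomputable def wordSrc (A : Set Homeo01) (m : Homeo01 → UI) : List Homeo01 → Set UI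
  | [] => ∅
  | a :: _ => symSrc A m a

/-- The destination of a word: the destination of its last symbol. -/
noncomputable def wordDest (A : Set Homeo01) (m : Homeo01 → UI) (w : List Homeo01) : Set UI :=
  match w.getLast? with
  | none => ∅
  | some a => symDest A m a

/-- `J(w) = supt(a) \ src(a)` where `a` is the first symbol of `w`. -/
noncomputable def Jset (A : Set Homeo01) (m : Homeo01 → UI) : List Homeo01 → Set UI
  | [] => ∅
  | a :: _ => supt a \ symSrc A m a

/-- `t` has trivial history: it lies in no foot of any element of `A`. -/
def TrivialHistory (A : Set Homeo01) (m : Homeo01 → UI) (t : UI) : Prop :=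
  ∀ a ∈ A, t ∉ src a (m a) ∧ t ∉ dest a (m a)

/-- `x` has finite history: there is a finite bound on the lengths of `A`-words
locally reduced at `x` whose evaluation at `x` is outside their destination. -/
def FiniteHistory (A : Set Homeo01) (m : Homeo01 → UI) (x : UI) : Prop :=
  ∃ n : ℕ, ∀ w : List Homeo01, WordOn A w → LocallyReducedAt w x →
    act x w ∉ wordDest A m w → w.length ≤ n

/-- A return word for `x`. -/
def IsReturnWord (x : UI) (w : List Homeo01) : Prop := w ≠ [] ∧ act x w = x

/-- `w` has a return prefix for `x`. -/
def HasReturnPrefix (x : UI) (w : List Homeo01) : Prop :=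
  ∃ v : List Homeo01, v <+: w ∧ IsReturnWord x v

/-- The set of initial markers of the marked family `(A, m)`. -/
def initialMarkers (A : Set Homeo01) (m : Homeo01 → UI) : Set UI :=
  {t | (∃ a ∈ A, m a = t) ∧ ∀ b ∈ A, m b < t → b (m b) ≠ t}

/-- `M⟨X⟩`: the orbit of the set of initial markers of `(A, m)` under the group
generated by `X`. -/
def MOrbit (A : Set Homeo01) (m : Homeo01 → UI) (X : Set Homeo01) : Set UI :=
  {u | ∃ t ∈ initialMarkers A m, ∃ g ∈ Subgroup.closure X, g t = u}

end PingPong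
namespace PingPong

/-! ### Piecewise linear maps and Thompson's group F -/

/-- `f` is piecewise linear (finitely many affine pieces). -/
def IsPL (f : Homeo01) : Prop :=
  ∃ (n : ℕ) (t : Fin (n + 1) → ℝ), StrictMono t ∧ t 0 = 0 ∧ t (Fin.last n) = 1 ∧
    ∀ i : Fin n, ∃ c d : ℝ, ∀ s : UI,
      t i.castSucc ≤ (s : ℝ) → (s : ℝ) ≤ t i.succ → ((f s : ℝ)) = c * (s : ℝ) + d

/-- `x` is a dyadic rational. -/
def IsDyadic (x : ℝ) : Prop := ∃ (a : ℤ) (k : ℕ), x = (a : ℝ) / 2 ^ k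

/-- `f` belongs to Thompson's group `F`: an orientation-preserving piecewise linear
homeomorphism of `[0,1]` with dyadic breakpoints and slopes integer powers of `2`. -/
def InThompsonF (f : Homeo01) : Prop :=
  IsOPH f ∧
  ∃ (n : ℕ) (t : Fin (n + 1) → ℝ), StrictMono t ∧ t 0 = 0 ∧ t (Fin.last n) = 1 ∧
    (∀ i, IsDyadic (t i)) ∧
    ∀ i : Fin n, ∃ (k : ℤ) (d : ℝ), ∀ s : UI,
      t i.castSucc ≤ (s : ℝ) → (s : ℝ) ≤ t i.succ → ((f s : ℝ)) = (2 : ℝ) ^ k * (s : ℝ) + d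

/-! ### Stretched transition chains -/

/-- `a` is isolated in `A`: its support contains no transition point of an element of `A`. -/
def IsolatedIn (A : Set Homeo01) (a : Homeo01) : Prop :=
  ∀ t ∈ supt a, ∀ b ∈ A, ¬ IsTransition b t

/-- `c` (with supports `(x i, y i)`) is a stretched transition chain of `A`. -/
def IsSTC (A : Set Homeo01) (k : ℕ) (c : Fin (k + 1) → Homeo01)
    (x y : Fin (k + 1) → ℝ) : Prop :=
  (∀ i, c i ∈ A ∧ ¬ IsolatedIn A (c i)) ∧
  (∀ i, supt (c i) = {t : UI | x i < (t : ℝ) ∧ (t : ℝ) < y i}) ∧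
  (∀ i : Fin k, x i.castSucc < x i.succ ∧ x i.succ < y i.castSucc ∧ y i.castSucc < y i.succ) ∧
  (∀ i : Fin k, ∀ t : UI, x i.succ < (t : ℝ) → (t : ℝ) < y i.castSucc →
    ∀ b ∈ A, ¬ IsTransition b t)

/-- `S` is the underlying set of some stretched transition chain of `A`. -/
def ChainSet (A : Set Homeo01) (S : Set Homeo01) : Prop :=
  ∃ (k : ℕ) (c : Fin (k + 1) → Homeo01) (x y : Fin (k + 1) → ℝ),
    IsSTC A k c x y ∧ S = Set.range c

/-- `S` is the underlying set of a maximal stretched transition chain of `A`. -/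
def MaxChainSet (A : Set Homeo01) (S : Set Homeo01) : Prop :=
  ChainSet A S ∧ ∀ S' : Set Homeo01, ChainSet A S' → S ⊆ S' → S = S'

/-- The transition points of `A` lying in the support of the chain `c`. -/
def chainTrans (A : Set Homeo01) (k : ℕ) (c : Fin (k + 1) → Homeo01) : Set UI :=
  {t | (∃ i, t ∈ supt (c i)) ∧ ∃ b ∈ A, IsTransition b t}

/-- The image of `t` under the composition `∏ C = c 0 ⋯ c k`. -/
def chainApply (k : ℕ) (c : Fin (k + 1) → Homeo01) (t : UI) : UI :=
  (List.ofFn c).foldl (fun s a => a s) t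

/-! ### Dynamical diagrams -/

/-- The collection of feet of the bumps used in `X`, with marking `m`. -/
def Feet (X : Set Homeo01) (m : Homeo01 → UI) : Set (Set UI) :=
  {S | ∃ a ∈ usedBumps X, S = src a (m a) ∨ S = dest a (m a)}

/-- The signed bumps of `f`: bumps agreeing with `f` on their support. -/
def signedBumps (f : Homeo01) : Set Homeo01 :=
  {b | IsBump b ∧ Set.EqOn ⇑b ⇑f (supt b)}

open Classical in
/-- The source of a signed bump, with respect to the marking `m` of the positive bumps. -/
noncomputable def sSrc (m : Homeo01 → UI) (b : Homeo01) : Set UI :=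
  if IsPosBump b then src b (m b) else dest b⁻¹ (m b⁻¹)

open Classical in
/-- The destination of a signed bump, with respect to the marking `m` of the positive bumps. -/
noncomputable def sDest (m : Homeo01 → UI) (b : Homeo01) : Set UI :=
  if IsPosBump b then dest b (m b) else src b⁻¹ (m b⁻¹)

/-- An isomorphism of the dynamical diagrams of the marked families `(X, mX)` and
`(Y, mY)`, inducing the bijection `τ : X → Y`: an order-preserving bijection `Φ`
between the collections of feet, together with, for each `f ∈ X`, a bijection of the
signed bumps of `f` with those of `τ f` under which `Φ` matches sources with sources
and destinations with destinations. -/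
def DiagIso (X : Set Homeo01) (mX : Homeo01 → UI) (Y : Set Homeo01) (mY : Homeo01 → UI)
    (τ : Homeo01 → Homeo01) : Prop :=
  Set.BijOn τ X Y ∧
  ∃ Φ : Set UI → Set UI,
    Set.BijOn Φ (Feet X mX) (Feet Y mY) ∧
    (∀ S ∈ Feet X mX, ∀ T ∈ Feet X mX,
      (∀ s ∈ S, ∀ t ∈ T, s < t) → ∀ s ∈ Φ S, ∀ t ∈ Φ T, s < t) ∧
    ∀ f ∈ X, ∃ β : Homeo01 → Homeo01,
      Set.BijOn β (signedBumps f) (signedBumps (τ f)) ∧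
      ∀ b ∈ signedBumps f, Φ (sSrc mX b) = sSrc mY (β b) ∧ Φ (sDest mX b) = sDest mY (β b)

/-! ### Excision -/

/-- The union of the supports of the bumps of `E` used in `f`. -/
def quotSupp (f : Homeo01) (E : Set Homeo01) : Set UI :=
  {t | ∃ a ∈ E, UsedIn f a ∧ t ∈ supt a}

/-- `g = f/E`: `g` is the identity on the supports of the bumps of `E` used in `f`,
and agrees with `f` elsewhere. -/
def IsQuot (f : Homeo01) (E : Set Homeo01) (g : Homeo01) : Prop :=
  (∀ t ∈ quotSupp f E, g t = t) ∧ ∀ t ∉ quotSupp f E, g t = f t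

/-- `E` is extraneous in `X` (with respect to the marking `m`), witnessed by an
interval `J`. -/
def Extraneous (X : Set Homeo01) (m : Homeo01 → UI) (E : Set Homeo01) : Prop :=
  ∃ J : Set UI, J.OrdConnected ∧ ∃ f ∈ X,
    (∀ e ∈ E, UsedIn f e ∧ IsolatedIn (usedBumps X) e ∧ supt e ⊆ J) ∧
    (∃ a : Homeo01, UsedIn f a ∧ a ∉ E ∧ (src a (m a) ⊆ J ∨ dest a (m a) ⊆ J)) ∧
    ∀ g ∈ X, g ≠ f → ∀ b : Homeo01, UsedIn g b →
      Disjoint (src b (m b)) J ∧ Disjoint (dest b (m b)) J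

end PingPong
namespace PingPong

/-! ### Fast systems of positive bumps -/

/-- A family of positive bumps `g i`, supported on `(lo (r (i, false)), hi (r (i, true)))`, whose
feet lie in the successive intervals `[lo k, hi k]` for `k < N`: the source of `g i` occupies the
interval number `r (i, false)` and its destination the interval number `r (i, true)`. -/
structure FastSystem {ι : Type*} {N : ℕ} (r : ι × Bool → Fin N) where
  lo : Fin N → UI
  hi : Fin N → UI
  g : ι → Homeo01
  mono : ∀ i, StrictMono (g i)
  lo_lt_hi : ∀ k, lo k < hi k
  hi_le_lo : ∀ k l, k < l → hi k ≤ lo l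
  inj : Function.Injective r
  gap : ∀ i, (r (i, false) : ℕ) + 1 < r (i, true)
  fix_left : ∀ i t, t ≤ lo (r (i, false)) → g i t = t
  fix_right : ∀ i t, hi (r (i, true)) ≤ t → g i t = t
  move : ∀ i t, lo (r (i, false)) < t → t < hi (r (i, true)) → t < g i t
  mark : ∀ i, g i (hi (r (i, false))) = lo (r (i, true))

/-- The inverse letter. -/
def flip {ι : Type*} (c : ι × Bool) : ι × Bool := (c.1, !c.2)

@[simp] lemma flip_flip {ι : Type*} (c : ι × Bool) : flip (flip c) = c := by simp [flip]

/-- `Allowed r c d`: the letter `c` moves the destination of the letter `d` and is not the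
inverse of `d`. -/
def Allowed {ι : Type*} {N : ℕ} (r : ι × Bool → Fin N) (c d : ι × Bool) : Prop :=
  c ≠ flip d ∧ r (c.1, false) ≤ r d ∧ r d ≤ r (c.1, true)

/-- Locally reduced words (the last letter acts first) on a base point at which the letters
satisfying `P` are allowed. -/
def Reduced {ι : Type*} {N : ℕ} (r : ι × Bool → Fin N) (P : ι × Bool → Prop) :
    List (ι × Bool) → Prop
  | [] => True
  | [c] => P c
  | c :: d :: s => Allowed r c d ∧ Reduced r P (d :: s)

open Classical in
/-- Left multiplication of a locally reduced word by a letter, followed by local reduction. -/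
noncomputable def push {ι : Type*} {N : ℕ} (r : ι × Bool → Fin N) (P : ι × Bool → Prop)
    (c : ι × Bool) : List (ι × Bool) → List (ι × Bool)
  | [] => if P c then [c] else []
  | d :: s => if c = flip d then s else if Allowed r c d then c :: d :: s else d :: s

section Reduction

variable {ι : Type*} {N : ℕ} {r : ι × Bool → Fin N} {P : ι × Bool → Prop}

lemma Reduced.tail {c : ι × Bool} {s : List (ι × Bool)} (h : Reduced r P (c :: s)) :
    Reduced r P s := by
  cases s with
  | nil => trivial
  | cons d s => exact h.2

lemma Reduced.push {s : List (ι × Bool)} (h : Reduced r P s) (c : ι × Bool) :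
    Reduced r P (push r P c s) := by
  cases s with
  | nil =>
    by_cases hc : P c
    · simpa [PingPong.push, hc] using (show Reduced r P [c] from hc)
    · simpa [PingPong.push, hc] using h
  | cons d s =>
    simp only [PingPong.push]
    split_ifs with h1 h2
    · exact h.tail
    · exact ⟨h2, h⟩
    · exact h

lemma length_le_push (c : ι × Bool) (s : List (ι × Bool)) :
    s.length ≤ (push r P c s).length + 1 := by
  cases s with
  | nil => simp
  | cons d s => simp only [push]; split_ifs <;> simp

lemma push_append (Q : ι × Bool → Prop) (c : ι × Bool) {s : List (ι × Bool)} (hs : s ≠ [])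
    (v : List (ι × Bool)) : push r Q c (s ++ v) = push r P c s ++ v := by
  cases s with
  | nil => exact absurd rfl hs
  | cons d s => simp only [List.cons_append, push]; split_ifs <;> rfl

lemma length_le_foldr_push (w s : List (ι × Bool)) :
    s.length ≤ (w.foldr (push r P) s).length + w.length := by
  induction w with
  | nil => simp
  | cons c w ih =>
    have := length_le_push (r := r) (P := P) c (w.foldr (push r P) s)
    simp only [List.foldr_cons, List.length_cons]
    omega

lemma foldr_push_ne_nil {w s : List (ι × Bool)} (h : w.length < s.length) :
    w.foldr (push r P) s ≠ [] := by
  intro h0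
  have := length_le_foldr_push (r := r) (P := P) w s
  rw [h0] at this
  simp only [List.length_nil] at this
  omega

lemma foldr_push_append (Q : ι × Bool → Prop) {w s : List (ι × Bool)}
    (h : w.length ≤ s.length) (v : List (ι × Bool)) :
    w.foldr (push r Q) (s ++ v) = w.foldr (push r P) s ++ v := by
  induction w with
  | nil => rfl
  | cons c w ih =>
    simp only [List.length_cons] at h
    simp only [List.foldr_cons]
    rw [ih (by omega), push_append (P := P) Q c (foldr_push_ne_nil (by omega))]

lemma Reduced.foldr_push {s : List (ι × Bool)} (h : Reduced r P s) (w : List (ι × Bool)) :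
    Reduced r P (w.foldr (PingPong.push r P) s) := by
  induction w with
  | nil => exact h
  | cons c w ih => exact ih.push c

lemma Reduced.append {d : ι × Bool} {s v : List (ι × Bool)}
    (hs : Reduced r (fun c => Allowed r c d) s) (hv : Reduced r P (d :: v)) :
    Reduced r P (s ++ d :: v) := by
  induction s with
  | nil => exact hv
  | cons c s ih =>
    cases s with
    | nil => exact ⟨hs, hv⟩
    | cons e s => exact ⟨hs.1, ih hs.2⟩

end Reduction

namespace FastSystem

variable {ι : Type*} {N : ℕ} {r : ι × Bool → Fin N} (S : FastSystem r)

/-- The representation of the free group given by a fast system. -/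
def rep : FreeGroup ι →* Homeo01 := FreeGroup.lift S.g

/-- The homeomorphism represented by a letter. -/
def letter (c : ι × Bool) : Homeo01 := cond c.2 (S.g c.1) (S.g c.1)⁻¹

/-- The homeomorphism represented by a word. -/
def act (w : List (ι × Bool)) : Homeo01 := (w.map S.letter).prod

lemma rep_mk (w : List (ι × Bool)) : S.rep (FreeGroup.mk w) = S.act w := by
  simp only [rep, FreeGroup.lift_mk, act]; rfl

@[simp] lemma act_nil : S.act [] = 1 := rfl

lemma act_cons (c : ι × Bool) (w : List (ι × Bool)) (t : UI) :
    S.act (c :: w) t = S.letter c (S.act w t) := by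
  simp [act]

lemma act_append (w v : List (ι × Bool)) (t : UI) :
    S.act (w ++ v) t = S.act w (S.act v t) := by
  simp [act]

lemma letter_flip (c : ι × Bool) : S.letter (flip c) = (S.letter c)⁻¹ := by
  rcases c with ⟨i, b⟩; cases b <;> simp [letter, flip]

lemma letter_flip_letter (c : ι × Bool) (t : UI) : S.letter (flip c) (S.letter c t) = t := by
  simp [letter_flip]

lemma letter_letter_flip (c : ι × Bool) (t : UI) : S.letter c (S.letter (flip c) t) = t := by
  simp [letter_flip]

/-- The destination of a letter: half-open for a bump and open for the inverse of a bump. -/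
def zone (c : ι × Bool) : Set UI :=
  {t | S.lo (r c) ≤ t ∧ t < S.hi (r c) ∧ (c.2 = false → S.lo (r c) < t)}

/-- A point outside all feet. -/
def IsFree (t : UI) : Prop := ∀ c, t ∉ S.zone c

/-- The letter `c` moves `t`. -/
def Moves (c : ι × Bool) (t : UI) : Prop :=
  S.lo (r (c.1, false)) < t ∧ t < S.hi (r (c.1, true))

variable {S}

lemma lt_of_lo_lt_hi {k l : Fin N} (h : S.lo k < S.hi l) : k ≤ l := by
  by_contra! hkl
  exact absurd (S.hi_le_lo _ _ hkl) (not_le.2 h)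

lemma le_lo {k l : Fin N} (h : k ≤ l) : S.lo k ≤ S.lo l := by
  rcases h.eq_or_lt with rfl | h
  · exact le_rfl
  · exact (S.lo_lt_hi k).le.trans (S.hi_le_lo _ _ h)

lemma le_hi {k l : Fin N} (h : k ≤ l) : S.hi k ≤ S.hi l := by
  rcases h.eq_or_lt with rfl | h
  · exact le_rfl
  · exact (S.hi_le_lo _ _ h).trans (S.lo_lt_hi l).le

lemma src_lt_dest (S : FastSystem r) (i : ι) : r (i, false) < r (i, true) := by
  have := S.gap i
  rw [Fin.lt_def]; omega

lemma zone_unique {c d : ι × Bool} {t : UI} (hc : t ∈ S.zone c) (hd : t ∈ S.zone d) : c = d :=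
  S.inj (le_antisymm (lt_of_lo_lt_hi (hc.1.trans_lt hd.2.1))
    (lt_of_lo_lt_hi (hd.1.trans_lt hc.2.1)))

lemma strictMono_inv {f : Homeo01} (hf : StrictMono f) : StrictMono (f⁻¹ : Homeo01) := by
  intro a b hab
  by_contra! h
  have := hf.monotone h
  simp only [Equiv.Perm.coe_inv, Equiv.apply_symm_apply] at this
  exact absurd hab (not_lt.2 this)

lemma strictMono_letter (c : ι × Bool) : StrictMono (S.letter c) := by
  rcases c with ⟨i, b⟩
  cases b
  · exact strictMono_inv (S.mono i)
  · exact S.mono i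

lemma strictMono_act (w : List (ι × Bool)) : StrictMono (S.act w) := by
  induction w with
  | nil => exact strictMono_id
  | cons c w ih =>
    intro a b hab
    rw [act_cons, act_cons]
    exact strictMono_letter c (ih hab)

lemma g_hi_dest (i : ι) : S.g i (S.hi (r (i, true))) = S.hi (r (i, true)) :=
  S.fix_right i _ le_rfl

lemma letter_fix {c : ι × Bool} {t : UI} (h : ¬ S.Moves c t) : S.letter c t = t := by
  have : S.g c.1 t = t := by
    by_cases h1 : t ≤ S.lo (r (c.1, false))
    · exact S.fix_left _ _ h1
    · exact S.fix_right _ _ (not_lt.1 fun h2 => h ⟨not_le.1 h1, h2⟩)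
  rcases c with ⟨i, b⟩
  cases b
  · exact (Equiv.Perm.inv_eq_iff_eq).2 this.symm
  · exact this

lemma Moves.letter {c d : ι × Bool} (hcd : c.1 = d.1) {t : UI} (h : S.Moves c t) :
    S.Moves c (S.letter d t) := by
  have h1 := strictMono_letter (S := S) d h.1
  have h2 := strictMono_letter (S := S) d h.2
  rw [letter_fix (c := d) (t := S.lo _) fun h => absurd h.1 (by rw [hcd]; exact lt_irrefl _)] at h1
  rw [letter_fix (c := d) (t := S.hi _) fun h => absurd h.2 (by rw [hcd]; exact lt_irrefl _)] at h2
  exact ⟨h1, h2⟩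

lemma moves_of_mem_zone {c d : ι × Bool} (hcd : c.1 = d.1) {t : UI} (h : t ∈ S.zone d) :
    S.Moves c t := by
  obtain ⟨h1, h2, h3⟩ := h
  rcases d with ⟨i, b⟩
  simp only at hcd
  subst hcd
  have := S.src_lt_dest c.1
  cases b
  · exact ⟨h3 rfl, h2.trans_le (le_hi this.le)⟩
  · exact ⟨((S.lo_lt_hi _).trans_le (S.hi_le_lo _ _ this)).trans_le h1, h2⟩

lemma moves_iff_of_mem_zone {c d : ι × Bool} {t : UI} (h : t ∈ S.zone d) :
    S.Moves c t ↔ r (c.1, false) ≤ r d ∧ r d ≤ r (c.1, true) := by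
  constructor
  · rintro ⟨h1, h2⟩
    exact ⟨lt_of_lo_lt_hi (h1.trans h.2.1), lt_of_lo_lt_hi (h.1.trans_lt h2)⟩
  · rintro ⟨h1, h2⟩
    rcases h1.eq_or_lt with h1 | h1
    · exact moves_of_mem_zone (by rw [← S.inj h1]) h
    · exact ⟨((S.lo_lt_hi _).trans_le (S.hi_le_lo _ _ h1)).trans_le h.1,
        h.2.1.trans_le (le_hi h2)⟩

/-- The ping-pong property. -/
lemma letter_mem_zone {c : ι × Bool} {t : UI} (h : S.Moves c t) (hn : t ∉ S.zone (flip c)) :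
    S.letter c t ∈ S.zone c := by
  have hm := h.letter (d := c) rfl
  rcases c with ⟨i, b⟩
  cases b
  · have h1 : t < S.lo (r (i, true)) := by
      by_contra! h1
      exact hn ⟨h1, h.2, fun h => by simp [flip] at h⟩
    have h2 := strictMono_letter (S := S) (i, false) h1
    have h3 : S.letter (i, false) (S.lo (r (i, true))) = S.hi (r (i, false)) :=
      (Equiv.Perm.inv_eq_iff_eq).2 (S.mark i).symm
    rw [h3] at h2
    exact ⟨hm.1.le, h2, fun _ => hm.1⟩
  · have h1 : S.hi (r (i, false)) ≤ t := by
      by_contra! h1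
      exact hn ⟨h.1.le, h1, fun _ => h.1⟩
    have h2 := (strictMono_letter (S := S) (i, true)).monotone h1
    have h3 : S.letter (i, true) (S.hi (r (i, false))) = S.lo (r (i, true)) := S.mark i
    rw [h3] at h2
    exact ⟨h2, hm.2, fun h => by simp at h⟩

lemma letter_flip_notMem_zone {c : ι × Bool} {t : UI} (h : t ∈ S.zone c) :
    S.letter (flip c) t ∉ S.zone (flip c) := by
  intro h1
  rcases c with ⟨i, b⟩
  cases b
  · have h2 := h.2.1
    have h3 : S.g i t < S.g i (S.hi (r (i, false))) := S.mono i h2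
    rw [S.mark] at h3
    exact absurd h1.1 (not_le.2 h3)
  · have h2 := h.1
    have h3 := (strictMono_letter (S := S) (i, false)).monotone h2
    have h4 : S.letter (i, false) (S.lo (r (i, true))) = S.hi (r (i, false)) :=
      (Equiv.Perm.inv_eq_iff_eq).2 (S.mark i).symm
    rw [h4] at h3
    exact absurd h1.2.1 (not_lt.2 h3)

/-- `P` describes letters which move the base point `t` away from their sources. -/
def IsBase (S : FastSystem r) (P : ι × Bool → Prop) (t : UI) : Prop :=
  ∀ c, P c → S.Moves c t ∧ t ∉ S.zone (flip c)

lemma IsFree.isBase {t : UI} (h : S.IsFree t) : S.IsBase (fun c => S.Moves c t) t :=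
  fun _ hc => ⟨hc, h _⟩

lemma isBase_of_mem_zone {d : ι × Bool} {t : UI} (h : t ∈ S.zone d) :
    S.IsBase (fun c => Allowed r c d) t := fun c hc =>
  ⟨(moves_iff_of_mem_zone h).2 hc.2, fun h1 => hc.1 (by rw [zone_unique h h1, flip_flip])⟩

variable {P : ι × Bool → Prop} {t : UI}

lemma act_mem_zone (hb : S.IsBase P t) {c : ι × Bool} {s : List (ι × Bool)}
    (h : Reduced r P (c :: s)) : S.act (c :: s) t ∈ S.zone c := by
  induction s generalizing c with
  | nil => rw [act_cons]; exact letter_mem_zone (hb c h).1 (hb c h).2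
  | cons d s ih =>
    have h1 := ih h.2
    rw [act_cons]
    exact letter_mem_zone (isBase_of_mem_zone h1 c h.1).1 (isBase_of_mem_zone h1 c h.1).2

lemma act_push_cons (hb : S.IsBase P t) {d : ι × Bool} {s : List (ι × Bool)}
    (h : Reduced r P (d :: s)) (c : ι × Bool) :
    S.act (push r P c (d :: s)) t = S.letter c (S.act (d :: s) t) := by
  have h1 := act_mem_zone hb h
  simp only [push]
  split_ifs with h2 h3
  · rw [h2, act_cons, letter_flip_letter]
  · rw [act_cons]
  · rw [letter_fix]
    rw [moves_iff_of_mem_zone h1]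
    exact fun h4 => h3 ⟨h2, h4⟩

lemma act_foldr_push_of_length_le (hb : S.IsBase P t) {s : List (ι × Bool)}
    (h : Reduced r P s) {w : List (ι × Bool)} (hw : w.length ≤ s.length) :
    S.act (w.foldr (push r P) s) t = S.act w (S.act s t) := by
  induction w with
  | nil => rfl
  | cons c w ih =>
    simp only [List.length_cons] at hw
    have h1 := foldr_push_ne_nil (r := r) (P := P) (show w.length < s.length by omega)
    have h2 := h.foldr_push w
    rw [List.foldr_cons, act_cons, ← ih (by omega)]
    obtain ⟨d, s', hs⟩ := List.exists_cons_of_ne_nil h1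
    rw [hs] at h2 ⊢
    exact act_push_cons hb h2 c

lemma act_foldr_push (ht : S.IsFree t) (hP : ∀ c, P c ↔ S.Moves c t) {s : List (ι × Bool)}
    (h : Reduced r P s) (w : List (ι × Bool)) :
    S.act (w.foldr (push r P) s) t = S.act w (S.act s t) := by
  have hb : S.IsBase P t := fun c hc => ⟨(hP c).1 hc, ht _⟩
  induction w with
  | nil => rfl
  | cons c w ih =>
    have h2 := h.foldr_push w
    rw [List.foldr_cons, act_cons, ← ih]
    cases hs : w.foldr (push r P) s with
    | nil =>
      simp only [push]
      split_ifs with h3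
      · rw [act_cons]
      · rw [act_nil, Equiv.Perm.one_apply, letter_fix (fun h4 => h3 ((hP c).2 h4))]
    | cons d s' =>
      rw [hs] at h2
      exact act_push_cons hb h2 c

lemma reduced_unique (ht : S.IsFree t) (hP : ∀ c, P c → S.Moves c t) {s s' : List (ι × Bool)}
    (h : Reduced r P s) (h' : Reduced r P s') (he : S.act s t = S.act s' t) : s = s' := by
  have hb : S.IsBase P t := fun c hc => ⟨hP c hc, ht _⟩
  induction s generalizing s' with
  | nil =>
    cases s' with
    | nil => rfl
    | cons d s' => exact absurd (act_mem_zone hb h') (he ▸ ht d)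
  | cons c s ih =>
    cases s' with
    | nil => exact absurd (act_mem_zone hb h) (he.symm ▸ ht c)
    | cons d s' =>
      have h1 := act_mem_zone hb h
      rw [he] at h1
      obtain rfl := zone_unique h1 (act_mem_zone hb h')
      rw [act_cons, act_cons] at he
      rw [ih h.tail h'.tail ((S.letter c).injective he)]

/-- The orbit of a free point contains no other free point. -/
lemma IsFree.eq_of_act_eq {t' : UI} (ht : S.IsFree t) (ht' : S.IsFree t') {w : List (ι × Bool)}
    (h : S.act w t = t') : t' = t := by
  have h1 := act_foldr_push (S := S) (P := fun c => S.Moves c t) ht (fun _ => Iff.rfl)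
    (s := []) trivial w
  rw [act_nil, Equiv.Perm.one_apply, h] at h1
  have h2 : Reduced r (fun c => S.Moves c t) (w.foldr (push r _) []) :=
    Reduced.foldr_push (s := []) trivial w
  cases hs : w.foldr (push r (fun c => S.Moves c t)) [] with
  | nil => rw [hs] at h1; exact h1.symm
  | cons c s =>
    rw [hs] at h1 h2
    exact absurd (h1 ▸ act_mem_zone ht.isBase h2) (ht' c)

lemma reduced_cons (hb : S.IsBase P t) (hP : ∀ c, P c ↔ S.Moves c t)
    {s : List (ι × Bool)} (h : Reduced r P s) {c : ι × Bool} (hc : S.Moves c (S.act s t))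
    (hn : S.act s t ∉ S.zone (flip c)) : Reduced r P (c :: s) := by
  cases s with
  | nil => exact (hP c).2 hc
  | cons d s =>
    have h1 := act_mem_zone hb h
    refine ⟨⟨?_, (moves_iff_of_mem_zone h1).1 hc⟩, h⟩
    rintro rfl
    exact hn (by rwa [flip_flip])

/-- Every point has either a finite history, or histories of any given length. -/
lemma exists_history (S : FastSystem r) (t : UI) (n : ℕ) :
    (∃ t₀ s, S.IsFree t₀ ∧ S.act s t₀ = t) ∨
    ∃ d t₀ s, t₀ ∈ S.zone d ∧ s.length = n ∧ Reduced r (fun c => Allowed r c d) s ∧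
      S.act s t₀ = t := by
  induction n with
  | zero =>
    by_cases h : S.IsFree t
    · exact Or.inl ⟨t, [], h, rfl⟩
    · simp only [IsFree, not_forall, not_not] at h
      obtain ⟨d, hd⟩ := h
      exact Or.inr ⟨d, t, [], hd, rfl, trivial, rfl⟩
  | succ n ih =>
    rcases ih with ih | ⟨d, t₀, s, hd, hs, hred, he⟩
    · exact Or.inl ih
    · have he' : S.act (s ++ [d]) (S.letter (flip d) t₀) = t := by
        rw [act_append, act_cons, act_nil, Equiv.Perm.one_apply, letter_letter_flip, he]
      by_cases h : S.IsFree (S.letter (flip d) t₀)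
      · exact Or.inl ⟨_, _, h, he'⟩
      · simp only [IsFree, not_forall, not_not] at h
        obtain ⟨e, hz⟩ := h
        refine Or.inr ⟨e, _, s ++ [d], hz, by simp [hs], ?_, he'⟩
        refine hred.append (P := fun c => Allowed r c e) (v := []) ⟨?_, ?_⟩
        · intro h1
          have h2 : e = flip d := by simpa using (congrArg flip h1).symm
          exact letter_flip_notMem_zone hd (h2 ▸ hz)
        · rw [← moves_iff_of_mem_zone hz]
          exact (moves_of_mem_zone rfl hd).letter (d := flip d) rfl

end FastSystem

namespace FastSystem

section Kernel

variable {ι : Type*} {N : ℕ} {r : ι × Bool → Fin N} {S T : FastSystem r} {θ : UI → UI}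

/-- A word representing an element of the free group. -/
noncomputable def word (w : FreeGroup ι) : List (ι × Bool) := Quot.out w

lemma rep_eq_act (S : FastSystem r) (w : FreeGroup ι) : S.rep w = S.act (word w) := by
  rw [← rep_mk]
  exact congrArg S.rep (Quot.out_eq w).symm

lemma rep_of (S : FastSystem r) (i : ι) : S.rep (FreeGroup.of i) = S.g i :=
  FreeGroup.lift_apply_of

/-- A monotone surjection carrying the fast system `S` to the fast system `T`. -/
structure IsSemiconj (S T : FastSystem r) (θ : UI → UI) : Prop where
  mono : Monotone θ
  surj : Function.Surjective θ
  map_lo : ∀ k, θ (S.lo k) = T.lo k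
  map_hi : ∀ k, θ (S.hi k) = T.hi k
  map_g : ∀ i t, θ (S.g i t) = T.g i (θ t)

/-- There are no gaps between the intervals of the fast system. -/
def IsTiled (T : FastSystem r) : Prop := ∀ k l : Fin N, (k : ℕ) + 1 = l → T.hi k = T.lo l

namespace IsSemiconj

lemma map_g_inv (h : IsSemiconj S T θ) (i : ι) (t : UI) :
    θ ((S.g i)⁻¹ t) = (T.g i)⁻¹ (θ t) := by
  apply (T.g i).injective
  rw [← h.map_g]
  simp

lemma map_letter (h : IsSemiconj S T θ) (c : ι × Bool) (t : UI) :
    θ (S.letter c t) = T.letter c (θ t) := by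
  rcases c with ⟨i, b⟩
  cases b
  · exact h.map_g_inv i t
  · exact h.map_g i t

lemma map_act (h : IsSemiconj S T θ) (w : List (ι × Bool)) (t : UI) :
    θ (S.act w t) = T.act w (θ t) := by
  induction w with
  | nil => rfl
  | cons c w ih => rw [act_cons, act_cons, h.map_letter, ih]

lemma map_rep (h : IsSemiconj S T θ) (w : FreeGroup ι) (t : UI) :
    θ (S.rep w t) = T.rep w (θ t) := by
  rw [rep_eq_act, rep_eq_act, h.map_act]

end IsSemiconj

/-- The first markers of a fast system are free; the others are images of smaller markers. -/
lemma isFree_hi_src (S : FastSystem r) (i : ι)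
    (h : ∀ c, (r (c, true) : ℕ) ≠ r (i, false) + 1) : S.IsFree (S.hi (r (i, false))) := by
  rintro ⟨c, b⟩ ⟨h1, h2, h3⟩
  have hlt : r (i, false) < r (c, b) := by
    by_contra! hle
    exact absurd h2 (not_lt.2 (le_hi hle))
  have heq := le_antisymm h1 (S.hi_le_lo _ _ hlt)
  cases b
  · exact absurd (h3 rfl) (by rw [heq]; exact lt_irrefl _)
  · have h4 : (r (i, false) : ℕ) + 1 < r (c, true) := by
      have := h c
      rw [Fin.lt_def] at hlt
      omega
    have hN := (r (c, true)).isLt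
    have h5 := S.hi_le_lo (r (i, false)) ⟨r (i, false) + 1, by omega⟩
      (by rw [Fin.lt_def]; simp)
    have h6 := S.lo_lt_hi ⟨r (i, false) + 1, by omega⟩
    have h7 := S.hi_le_lo ⟨r (i, false) + 1, by omega⟩ (r (c, true)) (by rw [Fin.lt_def]; exact h4)
    exact absurd heq (h5.trans_lt (h6.trans_le h7)).ne'

lemma src_lt_src_of_dest_eq (S : FastSystem r) {c i : ι}
    (h : (r (c, true) : ℕ) = r (i, false) + 1) : r (c, false) < r (i, false) := by
  have h1 := S.gap c
  rw [Fin.lt_def]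
  omega

lemma letter_true (S : FastSystem r) (i : ι) (t : UI) : S.letter (i, true) t = S.g i t := rfl

lemma hi_src_moves (S : FastSystem r) (i : ι) (b : Bool) :
    S.Moves (i, b) (S.hi (r (i, false))) :=
  ⟨S.lo_lt_hi _, (S.hi_le_lo _ _ (S.src_lt_dest i)).trans_lt (S.lo_lt_hi _)⟩

lemma hi_src_notMem_zone (S : FastSystem r) (i : ι) (b : Bool) :
    S.hi (r (i, false)) ∉ S.zone (i, b) := by
  rintro ⟨h1, h2, -⟩
  cases b
  · exact lt_irrefl _ h2
  · have h3 := S.move i _ (S.hi_src_moves i true).1 (S.hi_src_moves i true).2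
    rw [S.mark] at h3
    exact absurd h1 (not_le.2 h3)

lemma IsTiled.exists_reduced_marker (hT : T.IsTiled) (i : ι) :
    ∃ z u, T.IsFree z ∧ Reduced r (fun c => T.Moves c z) u ∧
      T.act u z = T.hi (r (i, false)) := by
  induction hn : (r (i, false) : ℕ) using Nat.strong_induction_on generalizing i with
  | _ n ih =>
    by_cases h : ∀ c, (r (c, true) : ℕ) ≠ r (i, false) + 1
    · exact ⟨_, [], T.isFree_hi_src i h, trivial, rfl⟩
    · push Not at h
      obtain ⟨c, hc⟩ := h
      have hlt := T.src_lt_src_of_dest_eq hc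
      rw [Fin.lt_def] at hlt
      obtain ⟨z, u, hz, hu, he⟩ := ih _ (hn ▸ hlt) c rfl
      refine ⟨z, (c, true) :: u, hz, ?_, ?_⟩
      · refine reduced_cons hz.isBase (fun _ => Iff.rfl) hu ?_ ?_
        · rw [he]; exact T.hi_src_moves c true
        · rw [he]; exact T.hi_src_notMem_zone c false
      · rw [act_cons, he, letter_true, T.mark, hT _ _ hc.symm]

lemma IsTiled.exists_reduced_cons (hT : T.IsTiled) (d : ι × Bool) :
    ∃ z u, T.IsFree z ∧ Reduced r (fun c => T.Moves c z) (d :: u) := by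
  obtain ⟨z, u, hz, hu, he⟩ := hT.exists_reduced_marker d.1
  refine ⟨z, u, hz, reduced_cons hz.isBase (fun _ => Iff.rfl) hu ?_ ?_⟩
  · rw [he]; exact T.hi_src_moves d.1 d.2
  · rw [he]; exact T.hi_src_notMem_zone d.1 _

/-- The point `q` is fixed by all elements acting trivially in `T`. -/
def KerFixed (S T : FastSystem r) (q : UI) : Prop := ∀ w, T.rep w = 1 → S.rep w q = q

lemma KerFixed.rep {q : UI} (h : KerFixed S T q) (x : FreeGroup ι) :
    KerFixed S T (S.rep x q) := by
  intro w hw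
  have h1 := h (x⁻¹ * w * x) (by simp [hw])
  have h2 := congrArg (S.rep x) h1
  simpa only [map_mul, map_inv, Equiv.Perm.mul_apply, Equiv.Perm.coe_inv,
    Equiv.apply_symm_apply] using h2

/-- Points with a long history are fixed by short words acting trivially in a tiled system. -/
lemma IsTiled.act_eq_of_history (hT : T.IsTiled) {d : ι × Bool} {t₀ : UI} (hd : t₀ ∈ S.zone d)
    {s w : List (ι × Bool)} (hs : Reduced r (fun c => Allowed r c d) s)
    (hl : w.length ≤ s.length) (hw : T.act w = 1) : S.act w (S.act s t₀) = S.act s t₀ := by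
  obtain ⟨z, u, hz, hu⟩ := hT.exists_reduced_cons d
  have h1 := hs.append hu
  have h2 := act_foldr_push hz (fun _ => Iff.rfl) h1 w
  rw [hw, Equiv.Perm.one_apply] at h2
  have h3 := reduced_unique hz (fun _ => id) (h1.foldr_push w) h1 h2
  rw [foldr_push_append (P := fun c => Allowed r c d) _ hl, List.append_left_inj] at h3
  rw [← act_foldr_push_of_length_le (isBase_of_mem_zone hd) hs hl, h3]

lemma moves_iff_of_free (h : IsSemiconj S T θ) {t : UI} (ht : S.IsFree t)
    (c : ι × Bool) : T.Moves c (θ t) ↔ S.Moves c t := by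
  constructor
  · rintro ⟨h1, h2⟩
    constructor
    · by_contra! h3
      exact absurd (h.mono h3) (not_le.2 (h.map_lo _ ▸ h1))
    · by_contra! h3
      exact absurd (h.mono h3) (not_le.2 (h.map_hi _ ▸ h2))
  · rintro ⟨h1, h2⟩
    have h3 : S.hi (r (c.1, false)) ≤ t := by
      by_contra! h3
      exact ht (c.1, false) ⟨h1.le, h3, fun _ => h1⟩
    have h4 := h.mono h3
    rw [h.map_hi] at h4
    refine ⟨(T.lo_lt_hi _).trans_le h4, ?_⟩
    have h5 : t < S.lo (r (c.1, true)) := by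
      by_contra! h5
      exact ht (c.1, true) ⟨h5, h2, fun h => by simp at h⟩
    have h6 := h.mono h5.le
    rw [h.map_lo] at h6
    exact h6.trans_lt (T.lo_lt_hi _)

lemma kerFixed_of_free (h : IsSemiconj S T θ) {t : UI} (ht : S.IsFree t)
    (ht' : T.IsFree (θ t)) : KerFixed S T t := by
  intro w hw
  rw [rep_eq_act] at hw ⊢
  have h1 := act_foldr_push ht' (P := fun c => S.Moves c t)
    (fun c => (moves_iff_of_free h ht c).symm) (s := []) trivial (word w)
  rw [hw, Equiv.Perm.one_apply] at h1
  have h2 := reduced_unique ht' (P := fun c => S.Moves c t)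
    (fun c => (moves_iff_of_free h ht c).2)
    (Reduced.foldr_push (s := []) trivial _) (s' := []) trivial h1
  have h3 := act_foldr_push ht (P := fun c => S.Moves c t) (fun c => Iff.rfl)
    (s := []) trivial (word w)
  rw [h2] at h3
  exact h3.symm

/-- To the right of a marker, in its fibre, we see either a point fixed by the kernel or points in
the orbit of a free point. -/
lemma exists_kerFixed_marker (h : IsSemiconj S T θ) (hT : T.IsTiled) (i : ι) :
    ∃ q, KerFixed S T q ∧ S.hi (r (i, false)) ≤ q ∧
      ∀ v, S.hi (r (i, false)) ≤ v → θ v = T.hi (r (i, false)) → q ≤ v ∨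
        ∃ s x, S.IsFree s ∧ S.rep x s = v ∧ θ s ≤ T.hi (r (i, false)) := by
  induction hn : (r (i, false) : ℕ) using Nat.strong_induction_on generalizing i with
  | _ n ih =>
    by_cases hc : ∀ c, (r (c, true) : ℕ) ≠ r (i, false) + 1
    · refine ⟨_, kerFixed_of_free h (S.isFree_hi_src i hc) ?_, le_rfl, fun v hv _ => Or.inl hv⟩
      rw [h.map_hi]
      exact T.isFree_hi_src i hc
    · push Not at hc
      obtain ⟨c, hc⟩ := hc
      have hlt := T.src_lt_src_of_dest_eq hc
      have hlt2 : r (i, false) < r (c, true) := by rw [Fin.lt_def]; omega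
      obtain ⟨q, hq, hq1, hq2⟩ := ih _ (hn ▸ Fin.lt_def.1 hlt) c rfl
      have hTe := hT _ _ hc.symm
      have hgq := (S.mono c).monotone hq1
      rw [S.mark] at hgq
      refine ⟨S.g c q, S.rep_of c ▸ hq.rep (FreeGroup.of c),
        (S.hi_le_lo _ _ hlt2).trans hgq, fun v hv1 hv2 => ?_⟩
      rcases lt_or_ge v (S.lo (r (c, true))) with hv3 | hv3
      · refine Or.inr ⟨v, 1, ?_, by simp, hv2.le⟩
        rintro e ⟨he1, he2, -⟩
        have h4 : r (i, false) < r e := by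
          by_contra! h4
          exact absurd (he2.trans_le (le_hi h4)) (not_lt.2 hv1)
        have h5 : r (c, true) ≤ r e := by
          rw [Fin.le_def]; rw [Fin.lt_def] at h4; omega
        exact absurd ((le_lo h5).trans he1) (not_le.2 hv3)
      · have hv4 : S.hi (r (c, false)) ≤ (S.g c)⁻¹ v := by
          by_contra! hv4
          have := S.mono c hv4
          rw [S.mark, Equiv.Perm.coe_inv, Equiv.apply_symm_apply] at this
          exact absurd hv3 (not_le.2 this)
        have hv5 : θ ((S.g c)⁻¹ v) = T.hi (r (c, false)) := by
          rw [h.map_g_inv, hv2, hTe, Equiv.Perm.inv_eq_iff_eq, T.mark]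
        rcases hq2 _ hv4 hv5 with h6 | ⟨s, x, hs, hx, hle⟩
        · left
          have := (S.mono c).monotone h6
          rwa [Equiv.Perm.coe_inv, Equiv.apply_symm_apply] at this
        · right
          refine ⟨s, FreeGroup.of c * x, hs, ?_, hle.trans (le_hi hlt.le)⟩
          rw [map_mul, Equiv.Perm.mul_apply, hx, rep_of, Equiv.Perm.coe_inv,
            Equiv.apply_symm_apply]

lemma IsFree.rep_eq {t t' : UI} (ht : S.IsFree t) (ht' : S.IsFree t') {w : FreeGroup ι}
    (h : S.rep w t = t') : t' = t := by
  rw [rep_eq_act] at h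
  exact ht.eq_of_act_eq ht' h

lemma not_lt_rep_of_free (h : IsSemiconj S T θ) (hT : T.IsTiled) {t : UI} (ht : S.IsFree t)
    {w : FreeGroup ι} (hw : T.rep w = 1) : ¬ t < S.rep w t := by
  intro hlt
  by_cases ht' : T.IsFree (θ t)
  · exact hlt.ne' (kerFixed_of_free h ht ht' w hw)
  have hθ : θ (S.rep w t) = θ t := by rw [h.map_rep, hw, Equiv.Perm.one_apply]
  simp only [IsFree, not_forall, not_not] at ht'
  obtain ⟨⟨i, b⟩, hz1, hz2, hz3⟩ := ht'
  have h1 : t < S.hi (r (i, b)) := by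
    by_contra! h1
    exact absurd (h.mono h1) (not_le.2 (h.map_hi _ ▸ hz2))
  have h2 : t ≤ S.lo (r (i, b)) := by
    by_contra! h2
    exact ht (i, b) ⟨h2.le, h1, fun _ => h2⟩
  have h3 : θ t = T.lo (r (i, b)) := le_antisymm (h.map_lo _ ▸ h.mono h2) hz1
  -- `θ t` is the left endpoint of a destination
  cases b
  · exact absurd (hz3 rfl) (by rw [h3]; exact lt_irrefl _)
  have h4 : t < S.lo (r (i, true)) := by
    refine lt_of_le_of_ne h2 fun h4 => ht (i, true) ⟨h4.ge, h1, fun h => by simp at h⟩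
  -- the image of `t` lies to the right of it
  have h5 : S.lo (r (i, true)) ≤ S.rep w t := by
    by_contra! h5
    by_cases hf : S.IsFree (S.rep w t)
    · exact hlt.ne' (ht.rep_eq hf rfl)
    simp only [IsFree, not_forall, not_not] at hf
    obtain ⟨e, he⟩ := hf
    have h6 : r e < r (i, true) := by
      by_contra! h6
      exact absurd ((le_lo h6).trans he.1) (not_le.2 h5)
    have h7 : t ≤ S.lo (r e) := by
      by_contra! h7
      exact ht e ⟨h7.le, hlt.trans he.2.1, fun _ => h7⟩
    have h8 := h.mono h7
    rw [h3, h.map_lo] at h8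
    exact absurd ((T.lo_lt_hi _).trans_le (T.hi_le_lo _ _ h6)) (not_lt.2 h8)
  obtain ⟨q, hq, hq1, hq2⟩ := exists_kerFixed_marker h hT i
  have h6 : S.hi (r (i, false)) ≤ (S.g i)⁻¹ (S.rep w t) := by
    by_contra! h6
    have := S.mono i h6
    rw [S.mark, Equiv.Perm.coe_inv, Equiv.apply_symm_apply] at this
    exact absurd h5 (not_le.2 this)
  have h7 : θ ((S.g i)⁻¹ (S.rep w t)) = T.hi (r (i, false)) := by
    rw [h.map_g_inv, hθ, h3, Equiv.Perm.inv_eq_iff_eq, T.mark]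
  rcases hq2 _ h6 h7 with h8 | ⟨s, x, hs, hx, hle⟩
  · have h9 := (S.mono i).monotone h8
    rw [Equiv.Perm.coe_inv, Equiv.apply_symm_apply] at h9
    have h10 := (S.mono i).monotone hq1
    rw [S.mark] at h10
    have h11 := (S.rep_of i ▸ hq.rep (FreeGroup.of i)) w hw
    have h12 : S.rep w t < S.rep w (S.g i q) := by
      rw [rep_eq_act]
      exact strictMono_act _ (h4.trans_le h10)
    rw [h11] at h12
    exact absurd h9 (not_le.2 h12)
  · have h8 : S.rep (w⁻¹ * FreeGroup.of i * x) s = t := by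
      rw [map_mul, map_mul, Equiv.Perm.mul_apply, hx, Equiv.Perm.mul_apply, rep_of]
      simp
    rw [← hs.rep_eq ht h8, h3] at hle
    have h9 := T.hi_src_moves i true
    have h10 := T.move i _ h9.1 h9.2
    rw [T.mark] at h10
    exact absurd hle (not_le.2 h10)

/-- The kernel of the representation does not depend on the fast system. -/
theorem IsSemiconj.rep_eq_one_iff (h : IsSemiconj S T θ) (hT : T.IsTiled) (w : FreeGroup ι) :
    S.rep w = 1 ↔ T.rep w = 1 := by
  constructor
  · intro hw
    ext1 t
    obtain ⟨s, rfl⟩ := h.surj t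
    rw [← h.map_rep, hw]
    rfl
  · intro hw
    ext1 t
    rcases exists_history S t (word w).length with ⟨t₀, s, ht₀, rfl⟩ | ⟨d, t₀, s, hd, hs, hr, rfl⟩
    · have hfix : KerFixed S T t₀ := by
        intro x hx
        refine le_antisymm (not_lt.1 (not_lt_rep_of_free h hT ht₀ hx)) (not_lt.1 fun hlt => ?_)
        refine not_lt_rep_of_free h hT ht₀ (w := x⁻¹) (by rw [map_inv, hx, inv_one]) ?_
        have := strictMono_act (S := S) (word x⁻¹) hlt
        rwa [← rep_eq_act, ← Equiv.Perm.mul_apply, ← map_mul, inv_mul_cancel, map_one,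
          Equiv.Perm.one_apply] at this
      rw [← rep_mk]
      exact hfix.rep _ w hw
    · rw [rep_eq_act] at hw ⊢
      exact hT.act_eq_of_history hd hr hs.ge hw

end Kernel

end FastSystem

/-! ### The piecewise linear model -/

/-- The piecewise linear bump supported on `(a, a + (D + 1) * w)` with slope `D` on
`[a, a + w]` and slope `1 / D` on the rest of its support. -/
noncomputable def bumpFn (a w D t : ℝ) : ℝ :=
  max t (min (a + D * (t - a)) (a + (D + 1) * w - (a + (D + 1) * w - t) / D))

section BumpFn

variable {a w D t : ℝ}

lemma bumpFn_strictMono (hD : 1 < D) : StrictMono (bumpFn a w D) := by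
  intro x y hxy
  have hD0 : 0 < D := by linarith
  refine max_lt_max hxy (min_lt_min ?_ ?_)
  · have := mul_lt_mul_of_pos_left hxy hD0
    linarith
  · have := div_lt_div_of_pos_right (sub_lt_sub_left hxy (a + (D + 1) * w)) hD0
    linarith

lemma bumpFn_continuous : Continuous (bumpFn a w D) := by
  unfold bumpFn
  fun_prop

lemma bumpFn_of_le (hD : 1 < D) (ht : t ≤ a) : bumpFn a w D t = t := by
  refine max_eq_left ((min_le_left _ _).trans ?_)
  nlinarith

lemma bumpFn_of_ge (hD : 1 < D) (ht : a + (D + 1) * w ≤ t) : bumpFn a w D t = t := by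
  refine max_eq_left ((min_le_right _ _).trans ?_)
  have : a + (D + 1) * w - t ≤ (a + (D + 1) * w - t) / D := by
    rw [le_div_iff₀ (by linarith)]
    nlinarith
  linarith

lemma bumpFn_src (hD : 1 < D) (h1 : a ≤ t) (h2 : t ≤ a + w) :
    bumpFn a w D t = a + D * (t - a) := by
  have h3 : (a + (D + 1) * w - t) / D ≤ (D + 1) * w - D * (t - a) := by
    rw [div_le_iff₀ (by linarith)]
    have h4 : 0 ≤ (D - 1) * ((D + 1) * (a + w - t)) :=
      mul_nonneg (by linarith) (mul_nonneg (by linarith) (by linarith))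
    linarith
  unfold bumpFn
  rw [min_eq_left (by linarith), max_eq_right (by nlinarith)]

lemma bumpFn_mid (hD : 1 < D) (h1 : a + w ≤ t) (h2 : t ≤ a + (D + 1) * w) :
    bumpFn a w D t = a + (D + 1) * w - (a + (D + 1) * w - t) / D := by
  have h3 : (D + 1) * w - D * (t - a) ≤ (a + (D + 1) * w - t) / D := by
    rw [le_div_iff₀ (by linarith)]
    have h4 : 0 ≤ (D - 1) * ((D + 1) * (t - (a + w))) :=
      mul_nonneg (by linarith) (mul_nonneg (by linarith) (by linarith))
    linarith
  have h5 : (a + (D + 1) * w - t) / D ≤ a + (D + 1) * w - t := by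
    rw [div_le_iff₀ (by linarith)]
    nlinarith
  unfold bumpFn
  rw [min_eq_right (by linarith), max_eq_right (by linarith)]

lemma lt_bumpFn (hD : 1 < D) (h1 : a < t) (h2 : t < a + (D + 1) * w) :
    t < bumpFn a w D t := by
  refine lt_max_of_lt_right (lt_min (by nlinarith) ?_)
  have h5 : (a + (D + 1) * w - t) / D < a + (D + 1) * w - t := by
    rw [div_lt_iff₀ (by linarith)]
    nlinarith
  linarith

end BumpFn

lemma surjective_of_continuous {f : UI → UI} (hf : Continuous f) (h0 : f 0 = 0) (h1 : f 1 = 1) :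
    Function.Surjective f := fun y =>
  intermediate_value_univ 0 1 hf ⟨by rw [h0]; exact y.2.1, by rw [h1]; exact y.2.2⟩

/-- A strictly increasing continuous function fixing `0` and `1` as a bijection. -/
noncomputable def ofStrictMono (f : ℝ → ℝ) (hf : StrictMono f) (hc : Continuous f)
    (h0 : f 0 = 0) (h1 : f 1 = 1) : Homeo01 :=
  Equiv.ofBijective
    (fun t : UI => (⟨f t, h0 ▸ hf.monotone t.2.1, h1 ▸ hf.monotone t.2.2⟩ : UI))
    ⟨fun x y hxy => Subtype.ext (hf.injective (congrArg Subtype.val hxy)),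
      surjective_of_continuous (by fun_prop) (Subtype.ext h0) (Subtype.ext h1)⟩

/-- The points of the uniform partition. -/
noncomputable def node (N k : ℕ) (h : k ≤ N) : UI :=
  ⟨(k : ℝ) / N, by positivity, div_le_one_of_le₀ (by exact_mod_cast h) (by positivity)⟩

lemma coe_node (N k : ℕ) (h : k ≤ N) : (node N k h : ℝ) = (k : ℝ) / N := rfl

section Model

variable {N s d : ℕ}

lemma node_lt_node {k l : ℕ} {hk : k ≤ N} {hl : l ≤ N} (h : k < l) : node N k hk < node N l hl := by
  have hN : (0 : ℝ) < N := by exact_mod_cast (by omega : 0 < N)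
  rw [← Subtype.coe_lt_coe, coe_node, coe_node]
  gcongr

lemma node_le_node {k l : ℕ} {hk : k ≤ N} {hl : l ≤ N} (h : k ≤ l) : node N k hk ≤ node N l hl := by
  rcases h.eq_or_lt with rfl | h
  · exact le_rfl
  · exact (node_lt_node h).le

lemma one_lt_cast_sub (h : s + 1 < d) : (1 : ℝ) < (d : ℝ) - s := by
  have : ((s + 1 : ℕ) : ℝ) < d := by exact_mod_cast h
  push_cast at this
  linarith

lemma model_right (s d N : ℕ) :
    (s : ℝ) / N + ((d : ℝ) - s + 1) * (1 / N) = ((d : ℝ) + 1) / N := by ring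

lemma model_mark (s N : ℕ) : (s : ℝ) / N + 1 / N = ((s : ℝ) + 1) / N := by ring

/-- The piecewise linear bump of the uniform partition with source number `s` and destination
number `d`. -/
noncomputable def modelBump (N s d : ℕ) (h : s + 1 < d) (hd : d < N) : Homeo01 :=
  ofStrictMono (bumpFn ((s : ℝ) / N) (1 / N) ((d : ℝ) - s))
    (bumpFn_strictMono (one_lt_cast_sub h)) bumpFn_continuous
    (bumpFn_of_le (one_lt_cast_sub h) (by positivity))
    (bumpFn_of_ge (one_lt_cast_sub h) (by
      rw [model_right]
      exact div_le_one_of_le₀ (by exact_mod_cast hd) (by positivity)))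

variable {h : s + 1 < d} {hd : d < N} {t : UI}

lemma modelBump_src (h1 : (s : ℝ) / N ≤ t) (h2 : (t : ℝ) ≤ ((s : ℝ) + 1) / N) :
    (modelBump N s d h hd t : ℝ) = (s : ℝ) / N + ((d : ℝ) - s) * (t - (s : ℝ) / N) := by
  rw [← model_mark] at h2
  exact bumpFn_src (one_lt_cast_sub h) h1 h2

lemma modelBump_mid (h1 : ((s : ℝ) + 1) / N ≤ t) (h2 : (t : ℝ) ≤ ((d : ℝ) + 1) / N) :
    (modelBump N s d h hd t : ℝ) =
      ((d : ℝ) + 1) / N - (((d : ℝ) + 1) / N - t) / ((d : ℝ) - s) := by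
  rw [← model_mark] at h1
  rw [← model_right s] at h2 ⊢
  exact bumpFn_mid (one_lt_cast_sub h) h1 h2

lemma modelBump_of_le (h1 : (t : ℝ) ≤ (s : ℝ) / N) : modelBump N s d h hd t = t :=
  Subtype.ext (bumpFn_of_le (one_lt_cast_sub h) h1)

lemma modelBump_of_ge (h1 : ((d : ℝ) + 1) / N ≤ t) : modelBump N s d h hd t = t := by
  rw [← model_right s] at h1
  exact Subtype.ext (bumpFn_of_ge (one_lt_cast_sub h) h1)

lemma lt_modelBump (h1 : (s : ℝ) / N < t) (h2 : (t : ℝ) < ((d : ℝ) + 1) / N) :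
    t < modelBump N s d h hd t := by
  rw [← model_right s] at h2
  exact lt_bumpFn (one_lt_cast_sub h) h1 h2

end Model

lemma modelBump_mark {N s d : ℕ} (h : s + 1 < d) (hd : d < N) :
    modelBump N s d h hd (node N (s + 1) (by omega)) = node N d hd.le := by
  have h0 : (node N (s + 1) (by omega) : ℝ) = ((s : ℝ) + 1) / N := by rw [coe_node]; push_cast; rfl
  refine Subtype.ext ?_
  rw [modelBump_src, h0, coe_node]
  · ring
  · rw [h0]; gcongr; linarith
  · rw [h0]

lemma modelBump_strictMono {N s d : ℕ} (h : s + 1 < d) (hd : d < N) :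
    StrictMono (modelBump N s d h hd) :=
  fun _ _ hxy => bumpFn_strictMono (one_lt_cast_sub h) hxy

namespace FastSystem

variable {ι : Type*} {N : ℕ} {r : ι × Bool → Fin N}

/-- The fast system of piecewise linear bumps of the uniform partition. -/
noncomputable def model (inj : Function.Injective r)
    (gap : ∀ i, (r (i, false) : ℕ) + 1 < r (i, true)) : FastSystem r where
  lo k := node N k k.2.le
  hi k := node N (k + 1) k.2
  g i := modelBump N _ _ (gap i) (r (i, true)).2
  mono i := modelBump_strictMono _ _
  lo_lt_hi k := node_lt_node (Nat.lt_succ_self _)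
  hi_le_lo k l h := node_le_node h
  inj := inj
  gap := gap
  fix_left i t h := modelBump_of_le h
  fix_right i t h := modelBump_of_ge (by
    rw [← Subtype.coe_le_coe, coe_node] at h; push_cast at h; exact h)
  move i t h1 h2 := lt_modelBump h1 (by
    rw [← Subtype.coe_lt_coe, coe_node] at h2; push_cast at h2; exact h2)
  mark i := modelBump_mark (gap i) (r (i, true)).2

lemma model_isTiled (inj : Function.Injective r)
    (gap : ∀ i, (r (i, false) : ℕ) + 1 < r (i, true)) : (model inj gap).IsTiled := by
  intro k l h
  simp only [model]
  congr 1

end FastSystem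

/-! ### The semiconjugacy to the model -/

namespace FastSystem

section Semiconjugacy

variable {ι : Type*} {N : ℕ} {r : ι × Bool → Fin N} (S : FastSystem r)

/-- The continuous monotone functions mapping the intervals of the fast system onto those of the
uniform partition. -/
def profiles : Set C(UI, ℝ) :=
  {f | (∀ s t, s ≤ t → f s ≤ f t) ∧ f 0 = 0 ∧ f 1 = 1 ∧
    ∀ k, f (S.lo k) = (k : ℝ) / N ∧ f (S.hi k) = ((k : ℝ) + 1) / N}

/-- A family of functions growing from `0` to `1 / N` on the intervals of the fast system. -/
structure IsSteps (u : Fin N → UI → ℝ) : Prop where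
  cont : ∀ k, Continuous (u k)
  mono : ∀ k, Monotone (u k)
  left : ∀ k t, t ≤ S.lo k → u k t = 0
  right : ∀ k t, S.hi k ≤ t → u k t = 1 / N

variable {S}

namespace IsSteps

variable {u : Fin N → UI → ℝ}

lemma sum_eq (hu : S.IsSteps u) {k : Fin N} {t : UI} (h1 : S.lo k ≤ t) (h2 : t ≤ S.hi k) :
    ∑ j, u j t = (k : ℝ) / N + u k t := by
  have h : ∀ j, u j t = (if j < k then (1 / N : ℝ) else 0) + if j = k then u k t else 0 := by
    intro j
    rcases lt_trichotomy j k with hjk | rfl | hjk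
    · rw [hu.right j t ((S.hi_le_lo _ _ hjk).trans h1)]
      simp [hjk, hjk.ne]
    · simp
    · rw [hu.left j t (h2.trans (S.hi_le_lo _ _ hjk))]
      simp [hjk.not_gt, hjk.ne']
  rw [Finset.sum_congr rfl fun j _ => h j, Finset.sum_add_distrib, Finset.sum_ite_eq',
    ← Finset.sum_filter, Finset.sum_const, nsmul_eq_mul]
  have hc : (Finset.univ.filter (· < k)).card = k := by
    rw [← Fin.card_Iio k]
    congr 1
    ext j
    simp
  rw [hc]
  simp [div_eq_mul_inv]

/-- The sum of a family of steps. -/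
def sum (hu : S.IsSteps u) : C(UI, ℝ) :=
  ⟨fun t => ∑ k, u k t, continuous_finsetSum _ fun k _ => hu.cont k⟩

lemma sum_apply (hu : S.IsSteps u) (t : UI) : hu.sum t = ∑ k, u k t := rfl

lemma sum_mem (hN : 0 < N) (hu : S.IsSteps u) : hu.sum ∈ S.profiles := by
  refine ⟨fun s t hst => ?_, ?_, ?_, fun k => ⟨?_, ?_⟩⟩
  · rw [sum_apply, sum_apply]
    exact Finset.sum_le_sum fun k _ => hu.mono k hst
  · rw [sum_apply]
    exact Finset.sum_eq_zero fun k _ => hu.left k 0 (S.lo k).2.1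
  · rw [sum_apply, Finset.sum_congr rfl fun k _ => hu.right k 1 (S.hi k).2.2, Finset.sum_const,
      Finset.card_univ, Fintype.card_fin, nsmul_eq_mul]
    field_simp
  · have := hu.sum_eq le_rfl (S.lo_lt_hi k).le
    rwa [hu.left k _ le_rfl, add_zero] at this
  · have := hu.sum_eq (S.lo_lt_hi k).le le_rfl
    rwa [hu.right k _ le_rfl, ← add_div] at this

end IsSteps

variable (S)

/-- The projection to an interval of the fast system. -/
def clamp (k : Fin N) (t : UI) : UI := max (S.lo k) (min t (S.hi k))

lemma clamp_mono (k : Fin N) : Monotone (S.clamp k) :=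
  fun _ _ h => max_le_max le_rfl (min_le_min h le_rfl)

lemma clamp_continuous (k : Fin N) : Continuous (S.clamp k) := by
  unfold clamp
  fun_prop

lemma clamp_of_le {k : Fin N} {t : UI} (h : t ≤ S.lo k) : S.clamp k t = S.lo k :=
  max_eq_left ((min_le_left _ _).trans h)

lemma clamp_of_ge {k : Fin N} {t : UI} (h : S.hi k ≤ t) : S.clamp k t = S.hi k := by
  rw [clamp, min_eq_right h, max_eq_right (S.lo_lt_hi k).le]

lemma clamp_eq {k : Fin N} {t : UI} (h1 : S.lo k ≤ t) (h2 : t ≤ S.hi k) : S.clamp k t = t := by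
  rw [clamp, min_eq_left h2, max_eq_right h1]

/-- The affine step. -/
noncomputable def linearStep (k : Fin N) (t : UI) : ℝ :=
  ((S.clamp k t : ℝ) - S.lo k) / (S.hi k - S.lo k) * (1 / N)

lemma isSteps_linearStep : S.IsSteps S.linearStep where
  cont k := by
    have := S.clamp_continuous k
    unfold linearStep
    fun_prop
  mono k s t h := by
    have h1 : (S.clamp k s : ℝ) ≤ S.clamp k t := S.clamp_mono k h
    have h2 : (0 : ℝ) < S.hi k - S.lo k := sub_pos.2 (S.lo_lt_hi k)
    unfold linearStep
    gcongr
  left k t h := by simp [linearStep, S.clamp_of_le h]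
  right k t h := by
    have h2 : ((S.hi k : ℝ) - S.lo k) ≠ 0 := (sub_pos.2 (Subtype.coe_lt_coe.2 (S.lo_lt_hi k))).ne'
    rw [linearStep, S.clamp_of_ge h, div_self h2, one_mul]

/-- The slope of the model bump. -/
def slope (r : ι × Bool → Fin N) (i : ι) : ℝ := (r (i, true) : ℝ) - r (i, false)

lemma two_le_slope (S : FastSystem r) (i : ι) : 2 ≤ slope r i := by
  have h : ((r (i, false) + 2 : ℕ) : ℝ) ≤ (r (i, true) : ℕ) := by exact_mod_cast S.gap i
  push_cast at h
  rw [slope]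
  linarith

open Classical in
/-- The steps defined by the functional equation of the semiconjugacy. -/
noncomputable def pullStep (f : C(UI, ℝ)) (k : Fin N) (t : UI) : ℝ :=
  if h : ∃ c, r c = k then
    (f (S.letter (flip h.choose) (S.clamp k t)) - f (S.letter (flip h.choose) (S.lo k))) /
      slope r h.choose.1
  else S.linearStep k t

lemma pullStep_foot (f : C(UI, ℝ)) (c : ι × Bool) (t : UI) :
    S.pullStep f (r c) t = (f (S.letter (flip c) (S.clamp (r c) t)) -
      f (S.letter (flip c) (S.lo (r c)))) / slope r c.1 := by
  have h : ∃ c', r c' = r c := ⟨c, rfl⟩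
  rw [pullStep, dif_pos h, S.inj h.choose_spec]

lemma pullStep_of_not (f : C(UI, ℝ)) {k : Fin N} (h : ¬ ∃ c, r c = k) (t : UI) :
    S.pullStep f k t = S.linearStep k t := by
  rw [pullStep, dif_neg h]

lemma letter_continuous (c : ι × Bool) : Continuous (S.letter c) :=
  (strictMono_letter c).monotone.continuous_of_surjective (S.letter c).surjective

variable {S}

lemma letter_flip_lo_mem {f : C(UI, ℝ)} (hf : f ∈ S.profiles) (c : ι × Bool) :
    f (S.letter (flip c) (S.lo (r c))) = ((r (c.1, false) : ℝ) + cond c.2 1 0) / N := by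
  rcases c with ⟨i, b⟩
  cases b
  · have h : S.letter (flip (i, false)) (S.lo (r (i, false))) = S.lo (r (i, false)) :=
      S.fix_left i _ le_rfl
    rw [h, (hf.2.2.2 _).1]
    simp
  · have h : S.letter (flip (i, true)) (S.lo (r (i, true))) = S.hi (r (i, false)) :=
      (Equiv.Perm.inv_eq_iff_eq).2 (S.mark i).symm
    rw [h, (hf.2.2.2 _).2]
    simp

lemma letter_flip_hi_mem {f : C(UI, ℝ)} (hf : f ∈ S.profiles) (c : ι × Bool) :
    f (S.letter (flip c) (S.hi (r c))) = ((r (c.1, true) : ℝ) + cond c.2 1 0) / N := by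
  rcases c with ⟨i, b⟩
  cases b
  · have h : S.letter (flip (i, false)) (S.hi (r (i, false))) = S.lo (r (i, true)) :=
      S.mark i
    rw [h, (hf.2.2.2 _).1]
    simp
  · have h : S.letter (flip (i, true)) (S.hi (r (i, true))) = S.hi (r (i, true)) :=
      (Equiv.Perm.inv_eq_iff_eq).2 (S.fix_right i _ le_rfl).symm
    rw [h, (hf.2.2.2 _).2]
    simp

lemma isSteps_pullStep {f : C(UI, ℝ)} (hf : f ∈ S.profiles) : S.IsSteps (S.pullStep f) where
  cont k := by
    by_cases h : ∃ c, r c = k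
    · obtain ⟨c, rfl⟩ := h
      have h1 := S.letter_continuous (flip c)
      have h2 := S.clamp_continuous (r c)
      simp only [funext (S.pullStep_foot f c)]
      fun_prop
    · rw [funext (S.pullStep_of_not f h)]
      exact S.isSteps_linearStep.cont k
  mono k := by
    by_cases h : ∃ c, r c = k
    · obtain ⟨c, rfl⟩ := h
      intro s t hst
      have h1 := hf.1 _ _ ((strictMono_letter (S := S) (flip c)).monotone (S.clamp_mono (r c) hst))
      have h2 := S.two_le_slope c.1
      rw [pullStep_foot, pullStep_foot]
      gcongr
    · rw [funext (S.pullStep_of_not f h)]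
      exact S.isSteps_linearStep.mono k
  left k t ht := by
    by_cases h : ∃ c, r c = k
    · obtain ⟨c, rfl⟩ := h
      rw [pullStep_foot, S.clamp_of_le ht, sub_self, zero_div]
    · rw [S.pullStep_of_not f h]
      exact S.isSteps_linearStep.left k t ht
  right k t ht := by
    by_cases h : ∃ c, r c = k
    · obtain ⟨c, rfl⟩ := h
      have h2 := S.two_le_slope c.1
      rw [pullStep_foot, S.clamp_of_ge ht, letter_flip_lo_mem hf, letter_flip_hi_mem hf, ← sub_div,
        add_sub_add_right_eq_sub, ← slope, div_div_cancel_left' (by linarith), one_div]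
    · rw [S.pullStep_of_not f h]
      exact S.isSteps_linearStep.right k t ht

lemma pullStep_dist {f f' : C(UI, ℝ)} (hf : f ∈ S.profiles) (hf' : f' ∈ S.profiles) (k : Fin N)
    (t : UI) : |S.pullStep f k t - S.pullStep f' k t| ≤ 1 / 2 * dist f f' := by
  by_cases h : ∃ c, r c = k
  · obtain ⟨c, rfl⟩ := h
    have h2 := S.two_le_slope c.1
    rw [pullStep_foot, pullStep_foot, letter_flip_lo_mem hf, letter_flip_lo_mem hf', ← sub_div,
      sub_sub_sub_cancel_right, abs_div, abs_of_pos (show 0 < slope r c.1 by linarith),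
      div_le_iff₀ (by linarith)]
    have h3 : |f (S.letter (flip c) (S.clamp (r c) t)) -
      f' (S.letter (flip c) (S.clamp (r c) t))| ≤ dist f f' := by
      rw [← Real.dist_eq]
      exact ContinuousMap.dist_apply_le_dist _
    nlinarith [dist_nonneg (x := f) (y := f')]
  · rw [S.pullStep_of_not f h, S.pullStep_of_not f' h, sub_self, abs_zero]
    positivity

lemma isClosed_profiles : IsClosed S.profiles := by
  have he : ∀ x : UI, Continuous fun f : C(UI, ℝ) => f x := fun x => by fun_prop
  have : S.profiles = (⋂ s, ⋂ t, ⋂ _ : s ≤ t, {f : C(UI, ℝ) | f s ≤ f t}) ∩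
      ({f | f 0 = 0} ∩ ({f | f 1 = 1} ∩
        ⋂ k, ({f | f (S.lo k) = (k : ℝ) / N} ∩ {f | f (S.hi k) = ((k : ℝ) + 1) / N}))) := by
    ext f
    simp only [profiles, mem_inter_iff, mem_iInter, mem_ofPred_eq]
  rw [this]
  refine IsClosed.inter ?_ (IsClosed.inter ?_ (IsClosed.inter ?_ ?_))
  · exact isClosed_iInter fun s => isClosed_iInter fun t => isClosed_iInter fun _ =>
      isClosed_le (he s) (he t)
  · exact isClosed_eq (he 0) continuous_const
  · exact isClosed_eq (he 1) continuous_const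
  · exact isClosed_iInter fun k => (isClosed_eq (he _) continuous_const).inter
      (isClosed_eq (he _) continuous_const)

/-- The operator whose fixed point is the semiconjugacy. -/
noncomputable def pull (hN : 0 < N) (f : S.profiles) : S.profiles :=
  ⟨(isSteps_pullStep f.2).sum, (isSteps_pullStep f.2).sum_mem hN⟩

lemma pull_contracting (hN : 0 < N) : ContractingWith (1 / 2) (pull (S := S) hN) := by
  refine ⟨by norm_num, LipschitzWith.of_dist_le_mul fun f f' => ?_⟩
  have hc : ((1 / 2 : NNReal) : ℝ) = 1 / 2 := by norm_num
  rw [Subtype.dist_eq, Subtype.dist_eq, hc, ContinuousMap.dist_le (by positivity)]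
  intro t
  rw [Real.dist_eq]
  change |∑ k, S.pullStep f k t - ∑ k, S.pullStep f' k t| ≤ _
  by_cases h : ∃ k, S.lo k ≤ t ∧ t ≤ S.hi k
  · obtain ⟨k, h1, h2⟩ := h
    rw [(isSteps_pullStep f.2).sum_eq h1 h2, (isSteps_pullStep f'.2).sum_eq h1 h2,
      add_sub_add_left_eq_sub]
    exact pullStep_dist f.2 f'.2 k t
  · have : ∀ k, S.pullStep f k t = S.pullStep f' k t := by
      intro k
      rcases le_or_gt t (S.lo k) with h1 | h1
      · rw [(isSteps_pullStep f.2).left k t h1, (isSteps_pullStep f'.2).left k t h1]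
      · have h2 : S.hi k ≤ t := by
          by_contra! h2
          exact h ⟨k, h1.le, h2.le⟩
        rw [(isSteps_pullStep f.2).right k t h2, (isSteps_pullStep f'.2).right k t h2]
    rw [Finset.sum_congr rfl fun k _ => this k, sub_self, abs_zero]
    positivity

/-- The functional equation has a solution. -/
lemma exists_profile (S : FastSystem r) (hN : 0 < N) : ∃ f ∈ S.profiles,
    ∀ k t, S.lo k ≤ t → t ≤ S.hi k → f t = (k : ℝ) / N + S.pullStep f k t := by
  have : CompleteSpace S.profiles := (isClosed_profiles (S := S)).completeSpace_coe
  have : Nonempty S.profiles := ⟨⟨_, S.isSteps_linearStep.sum_mem hN⟩⟩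
  have h := (pull_contracting (S := S) hN).fixedPoint_isFixedPt
  set f := ContractingWith.fixedPoint (pull (S := S) hN) (pull_contracting hN)
  refine ⟨f, f.2, fun k t h1 h2 => ?_⟩
  rw [← (isSteps_pullStep f.2).sum_eq h1 h2]
  exact congrArg (fun x : S.profiles => (x : C(UI, ℝ)) t) h.symm

/-- Every fast system is semiconjugate to the piecewise linear model. -/
theorem exists_isSemiconj_model (S : FastSystem r) :
    ∃ θ, Continuous θ ∧ IsSemiconj S (model S.inj S.gap) θ := by
  rcases Nat.eq_zero_or_pos N with rfl | hN
  · exact ⟨id, continuous_id, monotone_id, Function.surjective_id, fun k => k.elim0,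
      fun k => k.elim0, fun i => (r (i, true)).elim0⟩
  obtain ⟨f, hf, hfe⟩ := S.exists_profile hN
  have hmem : ∀ t, f t ∈ unitInterval := fun t =>
    ⟨hf.2.1 ▸ hf.1 _ _ t.2.1, hf.2.2.1 ▸ hf.1 _ _ t.2.2⟩
  have hc : Continuous fun t => (⟨f t, hmem t⟩ : UI) := by fun_prop
  refine ⟨fun t => ⟨f t, hmem t⟩, hc, fun s t h => hf.1 s t h,
    surjective_of_continuous hc (Subtype.ext hf.2.1) (Subtype.ext hf.2.2.1),
    fun k => Subtype.ext (hf.2.2.2 k).1, fun k => Subtype.ext ?_, fun i t => ?_⟩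
  · refine (hf.2.2.2 k).2.trans ?_
    simp [model, coe_node]
  have hD := S.two_le_slope i
  rcases le_total t (S.lo (r (i, false))) with h1 | h1
  · rw [S.fix_left i t h1]
    exact (modelBump_of_le (h := S.gap i) (hd := (r (i, true)).2)
      (by rw [← (hf.2.2.2 (r (i, false))).1]; exact hf.1 _ _ h1)).symm
  rcases le_total (S.hi (r (i, true))) t with h2 | h2
  · rw [S.fix_right i t h2]
    exact (modelBump_of_ge (h := S.gap i) (hd := (r (i, true)).2)
      (by rw [← (hf.2.2.2 (r (i, true))).2]; exact hf.1 _ _ h2)).symm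
  refine Subtype.ext ?_
  rcases le_total t (S.hi (r (i, false))) with h3 | h3
  · have h4 := hfe _ t h1 h3
    rw [S.pullStep_foot f (i, false), S.clamp_eq h1 h3, letter_flip_lo_mem hf] at h4
    refine Eq.trans ?_ (modelBump_src (h := S.gap i) (hd := (r (i, true)).2) ?_ ?_).symm
    · change f t = _ + (f (S.g i t) - _) / slope r i at h4
      change f (S.g i t) = _ + slope r i * (f t - _)
      rw [h4]
      field_simp
      simp
    · exact (hf.2.2.2 (r (i, false))).1 ▸ hf.1 _ _ h1
    · exact (hf.2.2.2 (r (i, false))).2 ▸ hf.1 _ _ h3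
  · have h5 : S.lo (r (i, true)) ≤ S.g i t := S.mark i ▸ (S.mono i).monotone h3
    have h6 : S.g i t ≤ S.hi (r (i, true)) := g_hi_dest (S := S) i ▸ (S.mono i).monotone h2
    have h4 := hfe _ _ h5 h6
    rw [S.pullStep_foot f (i, true), S.clamp_eq h5 h6, letter_flip_lo_mem hf] at h4
    have h7 : S.letter (flip (i, true)) (S.g i t) = t := S.letter_flip_letter (i, true) t
    rw [h7] at h4
    refine Eq.trans ?_ (modelBump_mid (h := S.gap i) (hd := (r (i, true)).2) ?_ ?_).symm
    · change f (S.g i t) = _ + (f t - _) / slope r i at h4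
      change f (S.g i t) = _ - (_ - f t) / slope r i
      have hNr : (N : ℝ) ≠ 0 := by positivity
      rw [h4]
      field_simp
      simp only [slope, cond_true]
      ring
    · exact (hf.2.2.2 (r (i, false))).2 ▸ hf.1 _ _ h3
    · exact (hf.2.2.2 (r (i, true))).2 ▸ hf.1 _ _ h2

end Semiconjugacy

end FastSystem

/-! ### Bumps -/

section Bumps

variable {f a b : Homeo01} {t x y : UI}

lemma inv_apply_self (f : Homeo01) (t : UI) : f⁻¹ (f t) = t := f.symm_apply_apply t

lemma apply_inv_self (f : Homeo01) (t : UI) : f (f⁻¹ t) = t := f.apply_symm_apply t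

lemma IsOPH.strictMono (hf : IsOPH f) : StrictMono f := hf.strictMono_of_injective f.injective

lemma IsOPH.continuous (hf : IsOPH f) : Continuous f :=
  Monotone.continuous_of_surjective hf f.surjective

lemma IsOPH.inv (hf : IsOPH f) : IsOPH f⁻¹ :=
  (FastSystem.strictMono_inv hf.strictMono).monotone

lemma IsOPH.map_zero (hf : IsOPH f) : f 0 = 0 := by
  obtain ⟨z, hz⟩ := f.surjective 0
  have h : f 0 ≤ f z := hf (show (0 : UI) ≤ z from z.2.1)
  exact le_antisymm (hz ▸ h) (f 0).2.1

lemma IsOPH.map_one (hf : IsOPH f) : f 1 = 1 := by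
  obtain ⟨z, hz⟩ := f.surjective 1
  have h : f z ≤ f 1 := hf (show z ≤ (1 : UI) from z.2.2)
  exact le_antisymm (f 1).2.2 (hz ▸ h)

lemma supt_inv (f : Homeo01) : supt f⁻¹ = supt f := by
  ext t
  exact not_congr (Equiv.Perm.inv_eq_iff_eq.trans eq_comm)

lemma apply_mem_supt (h : t ∈ supt f) : f t ∈ supt f := fun h1 => h (f.injective h1)

lemma inv_apply_mem_supt (h : t ∈ supt f) : f⁻¹ t ∈ supt f := by
  rw [← supt_inv] at h ⊢
  exact apply_mem_supt h

lemma IsOPH.sInf_notMem (hf : IsOPH f) : sInf (supt f) ∉ supt f := by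
  intro h
  rcases lt_or_gt_of_ne h with h1 | h1
  · exact absurd (sInf_le (apply_mem_supt h)) (not_le.2 h1)
  · have h2 := hf.inv.strictMono h1
    rw [inv_apply_self] at h2
    exact absurd (sInf_le (inv_apply_mem_supt h)) (not_le.2 h2)

lemma IsOPH.sSup_notMem (hf : IsOPH f) : sSup (supt f) ∉ supt f := by
  intro h
  rcases lt_or_gt_of_ne h with h1 | h1
  · have h2 := hf.inv.strictMono h1
    rw [inv_apply_self] at h2
    exact absurd (le_sSup (inv_apply_mem_supt h)) (not_le.2 h2)
  · exact absurd (le_sSup (apply_mem_supt h)) (not_le.2 h1)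

/-- The left endpoint of the support. -/
noncomputable def lEnd (f : Homeo01) : UI := sInf (supt f)

/-- The right endpoint of the support. -/
noncomputable def rEnd (f : Homeo01) : UI := sSup (supt f)

lemma IsBump.supt_eq (hf : IsBump f) : supt f = Ioo (lEnd f) (rEnd f) := by
  ext t
  constructor
  · intro h
    refine ⟨(sInf_le h).lt_of_ne ?_, (le_sSup h).lt_of_ne ?_⟩
    · rintro h1
      exact hf.1.sInf_notMem (h1 ▸ h)
    · rintro rfl
      exact hf.1.sSup_notMem h
  · rintro ⟨h1, h2⟩
    obtain ⟨s, hs, hst⟩ := sInf_lt_iff.1 h1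
    obtain ⟨u, hu, htu⟩ := lt_sSup_iff.1 h2
    exact hf.2.isPreconnected.ordConnected.out hs hu ⟨hst.le, htu.le⟩

lemma IsBump.lEnd_lt_rEnd (hf : IsBump f) : lEnd f < rEnd f := by
  obtain ⟨t, ht⟩ := hf.2.nonempty
  rw [hf.supt_eq] at ht
  exact ht.1.trans ht.2

lemma IsOPH.sign_of_isPreconnected (hf : IsOPH f) {s : Set UI} (hs : IsPreconnected s)
    (hne : ∀ t ∈ s, f t ≠ t) : (∀ t ∈ s, t < f t) ∨ ∀ t ∈ s, f t < t := by
  by_contra! h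
  obtain ⟨⟨u, hu, hu1⟩, v, hv, hv1⟩ := h
  obtain ⟨z, hz, hz1⟩ := hs.intermediate_value₂ hu hv hf.continuous.continuousOn
    continuousOn_id hu1 hv1
  exact hne z hz hz1

lemma IsBump.inv (hf : IsBump f) : IsBump f⁻¹ := ⟨hf.1.inv, by rw [supt_inv]; exact hf.2⟩

lemma IsBump.pos_or_pos_inv (hf : IsBump f) : IsPosBump f ∨ IsPosBump f⁻¹ := by
  refine (hf.1.sign_of_isPreconnected hf.2.isPreconnected fun t ht => ht).imp
    (fun h => ⟨hf, h⟩) fun h => ⟨hf.inv, fun t ht => ?_⟩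
  rw [supt_inv] at ht
  have := hf.inv.1.strictMono (h t ht)
  rwa [inv_apply_self] at this

lemma IsPosBump.inv_lt (ha : IsPosBump a) (ht : t ∈ supt a) : a⁻¹ t < t := by
  have := ha.2 _ (inv_apply_mem_supt ht)
  rwa [apply_inv_self] at this

lemma IsPosBump.not_inv (ha : IsPosBump a) : ¬ IsPosBump a⁻¹ := by
  intro h
  obtain ⟨t, ht⟩ := ha.1.2.nonempty
  exact lt_asymm (ha.inv_lt ht) (h.2 t (by rwa [supt_inv]))

lemma IsBump.fix_of_le (ha : IsBump a) (ht : t ≤ lEnd a) : a t = t := by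
  by_contra h
  have : t ∈ supt a := h
  rw [ha.supt_eq] at this
  exact absurd this.1 (not_lt.2 ht)

lemma IsBump.fix_of_ge (ha : IsBump a) (ht : rEnd a ≤ t) : a t = t := by
  by_contra h
  have : t ∈ supt a := h
  rw [ha.supt_eq] at this
  exact absurd this.2 (not_lt.2 ht)

lemma IsBump.fix_ends_of_eqOn (hf : IsOPH f) (ha : IsBump a) (h : EqOn f a (supt a)) :
    f (lEnd a) = lEnd a ∧ f (rEnd a) = rEnd a := by
  have hlt := ha.lEnd_lt_rEnd
  have h1 := h.closure hf.continuous ha.1.continuous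
  rw [ha.supt_eq, closure_Ioo hlt.ne] at h1
  exact ⟨(h1 ⟨le_rfl, hlt.le⟩).trans (ha.fix_of_le le_rfl),
    (h1 ⟨hlt.le, le_rfl⟩).trans (ha.fix_of_ge le_rfl)⟩

lemma lEnd_inv (a : Homeo01) : lEnd a⁻¹ = lEnd a := by rw [lEnd, supt_inv, lEnd]

lemma rEnd_inv (a : Homeo01) : rEnd a⁻¹ = rEnd a := by rw [rEnd, supt_inv, rEnd]

lemma UsedIn.fix_ends (hf : IsOPH f) (h : UsedIn f a) :
    f (lEnd a) = lEnd a ∧ f (rEnd a) = rEnd a := by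
  rcases h with ⟨ha, h | h⟩
  · exact ha.1.fix_ends_of_eqOn hf h
  · have := ha.1.inv.fix_ends_of_eqOn hf (by rwa [supt_inv])
    rwa [lEnd_inv, rEnd_inv] at this

lemma UsedIn.ne (h : UsedIn f a) (ht : t ∈ supt a) : f t ≠ t := by
  rcases h with ⟨ha, h | h⟩
  · rw [h ht]; exact ht
  · rw [h ht]; exact (ha.inv_lt ht).ne

/-- Two used bumps of the same homeomorphism with overlapping supports coincide. -/
lemma UsedIn.eq (hf : IsOPH f) (ha : UsedIn f a) (hb : UsedIn f b) (hta : t ∈ supt a)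
    (htb : t ∈ supt b) : a = b := by
  have hsa := ha.1.1.supt_eq
  have hsb := hb.1.1.supt_eq
  have key : ∀ {a b : Homeo01}, UsedIn f a → UsedIn f b → t ∈ supt a → t ∈ supt b →
      lEnd b ≤ lEnd a ∧ rEnd a ≤ rEnd b := by
    intro a b ha hb hta htb
    have h1 := ha.fix_ends hf
    have h2 := hb.fix_ends hf
    rw [ha.1.1.supt_eq] at hta
    rw [hb.1.1.supt_eq] at htb
    constructor
    · by_contra! h
      exact ha.ne (by rw [ha.1.1.supt_eq]; exact ⟨h, htb.1.trans hta.2⟩) h2.1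
    · by_contra! h
      exact ha.ne (by rw [ha.1.1.supt_eq]; exact ⟨hta.1.trans htb.2, h⟩) h2.2
  have h1 := key ha hb hta htb
  have h2 := key hb ha htb hta
  have hs : supt a = supt b := by
    rw [hsa, hsb, le_antisymm h1.1 h2.1, le_antisymm h1.2 h2.2]
  ext1 s
  by_cases hs1 : s ∈ supt a
  · have hs2 := hs ▸ hs1
    rcases ha.2 with h3 | h3 <;> rcases hb.2 with h4 | h4
    · rw [← h3 hs1, h4 hs2]
    · have h5 := ha.1.2 s hs1
      have h6 := hb.1.inv_lt hs2
      rw [← h4 hs2, h3 hs1] at h6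
      exact absurd h5 h6.not_gt
    · have h5 := hb.1.2 s hs2
      have h6 := ha.1.inv_lt hs1
      rw [← h3 hs1, h4 hs2] at h6
      exact absurd h5 h6.not_gt
    · have h5 := apply_mem_supt hs1
      have h6 := h3 h5
      rw [h4 (hs ▸ h5), inv_apply_self, Equiv.Perm.inv_eq_iff_eq] at h6
      exact h6
  · have hs2 := hs ▸ hs1
    rw [not_not.1 hs1, not_not.1 hs2]

/-- Each moved point of a homeomorphism lies in the support of one of its signed bumps. -/
lemma IsOPH.exists_mem_signedBumps (hf : IsOPH f) (ht : f t ≠ t) :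
    ∃ b ∈ signedBumps f, t ∈ supt b := by
  classical
  have hclosed : IsClosed {s | f s = s} := isClosed_eq hf.continuous continuous_id
  obtain ⟨x, ⟨hx1, hx2⟩, hx3⟩ := (isClosed_Iic.inter hclosed).isCompact.exists_isGreatest
    (s := Iic t ∩ {s | f s = s}) ⟨0, t.2.1, hf.map_zero⟩
  obtain ⟨y, ⟨hy1, hy2⟩, hy3⟩ := (isClosed_Ici.inter hclosed).isCompact.exists_isLeast
    (s := Ici t ∩ {s | f s = s}) ⟨1, t.2.2, hf.map_one⟩
  have hxt : x < t := lt_of_le_of_ne hx1 fun h => ht (h ▸ hx2)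
  have hty : t < y := lt_of_le_of_ne hy1 fun h => ht (h ▸ hy2)
  have hne : ∀ s ∈ Ioo x y, f s ≠ s := fun s hs h => by
    rcases le_total s t with h1 | h1
    · exact absurd (hx3 ⟨h1, h⟩) (not_le.2 hs.1)
    · exact absurd (hy3 ⟨h1, h⟩) (not_le.2 hs.2)
  have hp : ∀ s, f s ∈ Ioo x y ↔ s ∈ Ioo x y := fun s => by
    have h1 := hf.strictMono.lt_iff_lt (a := x) (b := s)
    have h2 := hf.strictMono.lt_iff_lt (a := s) (b := y)
    rw [show f x = x from hx2] at h1
    rw [show f y = y from hy2] at h2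
    exact and_congr h1 h2
  set b : Homeo01 := Equiv.Perm.ofSubtype (f.subtypePerm (p := (· ∈ Ioo x y)) hp) with hb
  have hin : ∀ s ∈ Ioo x y, b s = f s := fun s hs => by
    rw [hb, Equiv.Perm.ofSubtype_apply_of_mem _ hs]; rfl
  have hout : ∀ s ∉ Ioo x y, b s = s := fun s hs => by
    rw [hb, Equiv.Perm.ofSubtype_apply_of_not_mem _ hs]
  have hsupt : supt b = Ioo x y := by
    ext s
    by_cases hs : s ∈ Ioo x y
    · simp only [hs, iff_true]
      exact fun h => hne s hs ((hin s hs).symm.trans h)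
    · simp only [hs, iff_false]
      exact fun h => h (hout s hs)
  have hmono : IsOPH b := by
    intro s u hsu
    by_cases hs : s ∈ Ioo x y <;> by_cases hu : u ∈ Ioo x y
    · rw [hin s hs, hin u hu]; exact hf hsu
    · rw [hin s hs, hout u hu]
      have : y ≤ u := by
        by_contra! h
        exact hu ⟨hs.1.trans_le hsu, h⟩
      exact (((hp s).2 hs).2.le).trans this
    · rw [hout s hs, hin u hu]
      have : s ≤ x := by
        by_contra! h
        exact hs ⟨h, hsu.trans_lt hu.2⟩
      exact this.trans ((hp u).2 hu).1.le
    · rw [hout s hs, hout u hu]; exact hsu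
  refine ⟨b, ⟨⟨hmono, ?_⟩, ?_⟩, ?_⟩
  · rw [hsupt]; exact isConnected_Ioo (hxt.trans hty)
  · rw [hsupt]; exact hin
  · rw [hsupt]; exact ⟨hxt, hty⟩

lemma signedBumps_cases (h : b ∈ signedBumps f) :
    (IsPosBump b ∧ UsedIn f b) ∨ (¬ IsPosBump b ∧ UsedIn f b⁻¹) := by
  by_cases hb : IsPosBump b
  · exact Or.inl ⟨hb, hb, Or.inl h.2.symm⟩
  · refine Or.inr ⟨hb, h.1.pos_or_pos_inv.resolve_left hb, Or.inr ?_⟩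
    rw [inv_inv, supt_inv]
    exact h.2.symm

lemma IsOPH.exists_usedIn (hf : IsOPH f) (ht : f t ≠ t) : ∃ a, UsedIn f a ∧ t ∈ supt a := by
  obtain ⟨b, hb, htb⟩ := hf.exists_mem_signedBumps ht
  rcases signedBumps_cases hb with h | h
  · exact ⟨b, h.2, htb⟩
  · exact ⟨b⁻¹, h.2, by rwa [supt_inv]⟩

lemma UsedIn.isLeftTransition (hf : IsOPH f) (h : UsedIn f a) : IsLeftTransition f (lEnd a) := by
  refine ⟨not_not.2 (h.fix_ends hf).1, fun ε hε => ?_⟩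
  have hlt := h.1.1.lEnd_lt_rEnd
  have hlt' : (lEnd a : ℝ) < rEnd a := hlt
  have h0 := (lEnd a).2.1
  have h1 := (rEnd a).2.2
  refine ⟨⟨lEnd a + min ε (rEnd a - lEnd a) / 2, ?_, ?_⟩, ?_, ?_, ?_⟩
  · have : 0 < min ε ((rEnd a : ℝ) - lEnd a) := lt_min hε (by linarith)
    linarith
  · have : min ε ((rEnd a : ℝ) - lEnd a) ≤ rEnd a - lEnd a := min_le_right _ _
    linarith
  · have h2 : min ε ((rEnd a : ℝ) - lEnd a) ≤ rEnd a - lEnd a := min_le_right _ _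
    have h3 : 0 < min ε ((rEnd a : ℝ) - lEnd a) := lt_min hε (by linarith)
    refine h.ne (a := a) ?_
    rw [h.1.1.supt_eq]
    constructor
    · rw [← Subtype.coe_lt_coe]; simp only; linarith
    · rw [← Subtype.coe_lt_coe]; simp only; linarith
  · have h3 : 0 < min ε ((rEnd a : ℝ) - lEnd a) := lt_min hε (by linarith)
    rw [← Subtype.coe_lt_coe]; simp only; linarith
  · have h2 : min ε ((rEnd a : ℝ) - lEnd a) ≤ ε := min_le_left _ _
    have h3 : 0 < min ε ((rEnd a : ℝ) - lEnd a) := lt_min hε (by linarith)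
    simp only; linarith

end Bumps

/-! ### Bumps with disjoint feet form fast systems -/

/-- A family of marked positive bumps with pairwise disjoint feet. -/
structure MarkedBumps (ι : Type*) where
  g : ι → Homeo01
  m : ι → UI
  pos : ∀ i, IsPosBump (g i)
  mem : ∀ i, m i ∈ supt (g i)
  disj : ∀ c d : ι × Bool, c ≠ d →
    Disjoint (foot (g c.1) (m c.1) c.2) (foot (g d.1) (m d.1) d.2)

namespace MarkedBumps

variable {ι : Type*} (B : MarkedBumps ι)

/-- The left endpoint of a foot. -/
noncomputable def fl (c : ι × Bool) : UI := cond c.2 (B.g c.1 (B.m c.1)) (lEnd (B.g c.1))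

/-- The right endpoint of a foot. -/
noncomputable def fh (c : ι × Bool) : UI := cond c.2 (rEnd (B.g c.1)) (B.m c.1)

lemma mid_lt (i : ι) : B.fh (i, false) < B.fl (i, true) := (B.pos i).2 _ (B.mem i)

lemma fl_lt_fh (c : ι × Bool) : B.fl c < B.fh c := by
  rcases c with ⟨i, b⟩
  have h1 := B.mem i
  have h2 := apply_mem_supt h1
  rw [(B.pos i).1.supt_eq] at h1 h2
  cases b
  · exact h1.1
  · exact h2.2

lemma mem_foot {c : ι × Bool} {t : UI} : t ∈ foot (B.g c.1) (B.m c.1) c.2 ↔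
    B.fl c ≤ t ∧ t < B.fh c ∧ (c.2 = false → B.fl c < t) := by
  rcases c with ⟨i, b⟩
  have h1 := B.mem i
  have h2 := apply_mem_supt h1
  rw [(B.pos i).1.supt_eq] at h1 h2
  cases b
  · simp only [foot, src, (B.pos i).1.supt_eq, mem_ofPred_eq, fl, fh, cond_false, mem_Ioo,
      forall_const]
    exact ⟨fun h => ⟨h.1.1.le, h.2, h.1.1⟩, fun h => ⟨⟨h.2.2, h.2.1.trans h1.2⟩, h.2.1⟩⟩
  · simp only [foot, dest, (B.pos i).1.supt_eq, mem_ofPred_eq, fl, fh, cond_true, mem_Ioo,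
      reduceCtorEq, IsEmpty.forall_iff, and_true]
    exact ⟨fun h => ⟨h.2, h.1.2⟩, fun h => ⟨⟨h2.1.trans_le h.1, h.2⟩, h.1⟩⟩

lemma fh_le_fl_or {c d : ι × Bool} (h : c ≠ d) : B.fh c ≤ B.fl d ∨ B.fh d ≤ B.fl c := by
  by_contra! hc
  obtain ⟨t, ht1, ht2⟩ := exists_between
    (max_lt (lt_min (B.fl_lt_fh c) hc.2) (lt_min hc.1 (B.fl_lt_fh d)))
  rw [max_lt_iff] at ht1
  rw [lt_min_iff] at ht2
  exact Set.disjoint_left.1 (B.disj c d h) (B.mem_foot.2 ⟨ht1.1.le, ht2.1, fun _ => ht1.1⟩)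
    (B.mem_foot.2 ⟨ht1.2.le, ht2.2, fun _ => ht1.2⟩)

lemma fh_le_fl_of_lt {c d : ι × Bool} (h : B.fl c < B.fl d) : B.fh c ≤ B.fl d :=
  (B.fh_le_fl_or fun hcd => h.ne (congrArg B.fl hcd)).resolve_right fun h1 =>
    absurd (h.trans ((B.fl_lt_fh d).trans_le h1)) (lt_irrefl _)

lemma fl_injective : Function.Injective B.fl := by
  intro c d h
  by_contra hcd
  have h1 := B.fl_lt_fh c
  have h2 := B.fl_lt_fh d
  rcases B.fh_le_fl_or hcd with h3 | h3
  · exact absurd (h1.trans_le h3) (h ▸ lt_irrefl _)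
  · exact absurd (h2.trans_le h3) (h ▸ lt_irrefl _)

/-- A ranking of the feet in which each bump has another interval between its source and its
destination, every interval which is not the place of a foot being the only interval between the
source and the destination of some bump. -/
structure IsRanking {N : ℕ} (r : ι × Bool → Fin N) : Prop where
  inj : Function.Injective r
  gap : ∀ i, (r (i, false) : ℕ) + 1 < r (i, true)
  hole : ∀ k ∉ range r, ∃ i, (r (i, false) : ℕ) + 1 = k ∧ (k : ℕ) + 1 = r (i, true)

/-- The feet of `B` are ordered according to the ranking `r`. -/
def IsOrderedBy {N : ℕ} (r : ι × Bool → Fin N) : Prop := ∀ c d, r c < r d → B.fh c ≤ B.fl d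

theorem exists_isRanking [Finite ι] :
    ∃ (N : ℕ) (r : ι × Bool → Fin N), IsRanking r ∧ B.IsOrderedBy r := by
  classical
  have := Fintype.ofFinite ι
  let iso : ι → Prop := fun i => ∀ c, B.fl (i, false) < B.fl c → ¬ B.fl c < B.fl (i, true)
  let K : Finset UI := Finset.univ.image B.fl ∪
    (Finset.univ.filter iso).image fun i => B.fh (i, false)
  have hK : ∀ x, x ∈ K ↔ (∃ c, B.fl c = x) ∨ ∃ i, iso i ∧ B.fh (i, false) = x := by
    intro x; simp [K]
  let e := K.orderIsoOfFin rfl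
  have hfl : ∀ c, B.fl c ∈ K := fun c => (hK _).2 (Or.inl ⟨c, rfl⟩)
  let r : ι × Bool → Fin K.card := fun c => e.symm ⟨B.fl c, hfl c⟩
  have hmid : ∀ i, iso i → ∀ x ∈ K, B.fl (i, false) < x → x < B.fl (i, true) →
      x = B.fh (i, false) := by
    intro i hi x hx h1 h2
    rcases (hK x).1 hx with ⟨c, rfl⟩ | ⟨j, hj, rfl⟩
    · exact absurd h2 (hi c h1)
    · by_cases hij : i = j
      · rw [hij]
      · rcases B.fh_le_fl_or (c := (i, false)) (d := (j, false)) (by simp [hij]) with h3 | h3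
        · exact absurd ((B.fl_lt_fh (j, false)).trans h2)
            (hi _ ((B.fl_lt_fh (i, false)).trans_le h3))
        · exact absurd h1 (not_lt.2 h3)
  have hlt : ∀ c (k : Fin K.card), r c < k ↔ B.fl c < e k := fun c k => by
    rw [OrderIso.symm_apply_lt]; rfl
  have hgt : ∀ c (k : Fin K.card), k < r c ↔ e k < B.fl c := fun c k => by
    rw [OrderIso.lt_symm_apply]; rfl
  refine ⟨K.card, r, ⟨?_, ?_, ?_⟩, ?_⟩
  · intro c d h
    exact B.fl_injective (congrArg Subtype.val (e.symm.injective h))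
  · intro i
    obtain ⟨x, hx, h1, h2⟩ : ∃ x ∈ K, B.fl (i, false) < x ∧ x < B.fl (i, true) := by
      by_cases hi : iso i
      · exact ⟨_, (hK _).2 (Or.inr ⟨i, hi, rfl⟩), B.fl_lt_fh _, B.mid_lt i⟩
      · simp only [iso] at hi
        push Not at hi
        obtain ⟨c, hc⟩ := hi
        exact ⟨_, hfl c, hc⟩
    have h3 := (hlt (i, false) (e.symm ⟨x, hx⟩)).2 (by simpa using h1)
    have h4 := (hgt (i, true) (e.symm ⟨x, hx⟩)).2 (by simpa using h2)
    rw [Fin.lt_def] at h3 h4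
    omega
  · intro k hk
    rcases (hK _).1 (e k).2 with ⟨c, hc⟩ | ⟨i, hi, hx⟩
    · refine absurd ⟨c, ?_⟩ hk
      rw [← e.symm_apply_apply k]
      exact congrArg e.symm (Subtype.ext hc)
    · have h1 := (hlt (i, false) k).2 (by rw [← hx]; exact B.fl_lt_fh _)
      have h2 := (hgt (i, true) k).2 (by rw [← hx]; exact B.mid_lt i)
      have key : ∀ l : Fin K.card, r (i, false) < l → l < r (i, true) → l = k := by
        intro l h3 h4
        apply e.injective
        apply Subtype.ext
        rw [hmid i hi _ (e l).2 ((hlt _ _).1 h3) ((hgt _ _).1 h4), hx]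
      refine ⟨i, ?_, ?_⟩
      · by_contra hne
        have h3 := key ⟨r (i, false) + 1, by omega⟩
          (by rw [Fin.lt_def]; simp only; omega) (by rw [Fin.lt_def]; simp only; omega)
        exact hne (congrArg Fin.val h3)
      · by_contra hne
        have h3 := key ⟨k + 1, by omega⟩
          (by rw [Fin.lt_def]; simp only; omega) (by rw [Fin.lt_def]; simp only; omega)
        have := congrArg Fin.val h3
        simp only at this
        omega
  · intro c d h
    exact B.fh_le_fl_of_lt ((hlt c (r d)).1 h |>.trans_eq (by simp [r]))

variable {B}

theorem IsOrderedBy.exists_fastSystem {N : ℕ} {r : ι × Bool → Fin N} (ho : B.IsOrderedBy r)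
    (hr : IsRanking r) :
    ∃ S : FastSystem r, S.g = B.g ∧ ∀ c, S.lo (r c) = B.fl c ∧ S.hi (r c) = B.fh c := by
  have hex : ∀ k : Fin N, ∃ p : UI × UI, (∃ c, r c = k ∧ p.1 = B.fl c ∧ p.2 = B.fh c) ∨
      (k ∉ range r ∧ ∃ i, (r (i, false) : ℕ) + 1 = k ∧ (k : ℕ) + 1 = r (i, true) ∧
        p.1 = B.fh (i, false) ∧ p.2 = B.fl (i, true)) := by
    intro k
    by_cases hk : k ∈ range r
    · obtain ⟨c, hc⟩ := hk
      exact ⟨(B.fl c, B.fh c), Or.inl ⟨c, hc, rfl, rfl⟩⟩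
    · obtain ⟨i, h1, h2⟩ := hr.hole k hk
      exact ⟨(B.fh (i, false), B.fl (i, true)), Or.inr ⟨hk, i, h1, h2, rfl, rfl⟩⟩
  choose p hp using hex
  have hpr : ∀ c, (p (r c)).1 = B.fl c ∧ (p (r c)).2 = B.fh c := by
    intro c
    rcases hp (r c) with ⟨d, hd, h⟩ | ⟨h, -⟩
    · rwa [hr.inj hd] at h
    · exact absurd ⟨c, rfl⟩ h
  have hfh : ∀ c d, r c ≤ r d → B.fh c ≤ B.fh d := by
    intro c d h
    rcases h.eq_or_lt with h | h
    · rw [hr.inj h]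
    · exact (ho c d h).trans (B.fl_lt_fh d).le
  have hfl : ∀ c d, r c ≤ r d → B.fl c ≤ B.fl d := by
    intro c d h
    rcases h.eq_or_lt with h | h
    · rw [hr.inj h]
    · exact (B.fl_lt_fh c).le.trans (ho c d h)
  refine ⟨⟨fun k => (p k).1, fun k => (p k).2, B.g, fun i => (B.pos i).1.1.strictMono,
    ?_, ?_, hr.inj, hr.gap, ?_, ?_, ?_, ?_⟩, rfl, hpr⟩
  · intro k
    rcases hp k with ⟨c, -, h1, h2⟩ | ⟨-, i, -, -, h1, h2⟩
    · rw [h1, h2]; exact B.fl_lt_fh c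
    · rw [h1, h2]; exact B.mid_lt i
  · intro k l hkl
    have hkl' := Fin.lt_def.1 hkl
    rcases hp k with ⟨c, hc, -, h2⟩ | ⟨hk, i, hi1, hi2, -, h2⟩ <;>
      rcases hp l with ⟨d, hd, h3, -⟩ | ⟨hl, j, hj1, hj2, h3, -⟩ <;> rw [h2, h3]
    · exact ho c d (by rw [hc, hd]; exact hkl)
    · exact hfh c _ (Fin.le_def.2 (by rw [hc]; omega))
    · exact hfl _ d (Fin.le_def.2 (by rw [hd]; omega))
    · have hne : (r (i, true) : ℕ) ≠ l := fun h => hl ⟨_, Fin.ext h⟩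
      exact (hfl _ _ (Fin.le_def.2 (by omega))).trans (B.fl_lt_fh (j, false)).le
  · intro i t ht
    rw [(hpr _).1] at ht
    exact (B.pos i).1.fix_of_le ht
  · intro i t ht
    rw [(hpr _).2] at ht
    exact (B.pos i).1.fix_of_ge ht
  · intro i t h1 h2
    rw [(hpr _).1] at h1
    rw [(hpr _).2] at h2
    refine (B.pos i).2 t ?_
    rw [(B.pos i).1.supt_eq]
    exact ⟨h1, h2⟩
  · intro i
    rw [(hpr _).1, (hpr _).2]
    rfl

end MarkedBumps

/-! ### Elements assembled from the bumps of a fast system -/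

/-- An assignment of signs to bumps and of signed bumps to elements, bumps of the same element
having disjoint supports. -/
structure Assembly {ι : Type*} {N : ℕ} (r : ι × Bool → Fin N) (J : Type*) where
  owner : ι → J
  sign : ι → Bool
  sep : ∀ i k, i ≠ k → owner i = owner k →
    r (i, true) < r (k, false) ∨ r (k, true) < r (i, false)

section Assembly

variable {ι : Type*} {N : ℕ} {r : ι × Bool → Fin N} {J : Type*} (C : Assembly r J)

open Classical in
/-- The word formed by the signed bumps of an element. -/
noncomputable def Assembly.word [Fintype ι] (j : J) : FreeGroup ι :=
  FreeGroup.mk ((Finset.univ.filter (C.owner · = j)).toList.map fun i => (i, C.sign i))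

namespace FastSystem

variable (S : FastSystem r)

/-- The element of an assembly given by a fast system. -/
noncomputable def elt [Fintype ι] (j : J) : Homeo01 := S.rep (C.word j)

/-- The signed bump of an assembly given by a fast system. -/
def bump (i : ι) : Homeo01 := S.letter (i, C.sign i)

variable {S C} {i k : ι} {j : J} {f a : Homeo01} {t : UI} {m : Homeo01 → UI}

lemma supt_g (S : FastSystem r) (i : ι) :
    supt (S.g i) = Ioo (S.lo (r (i, false))) (S.hi (r (i, true))) := by
  ext t
  refine ⟨fun h => ?_, fun h => (S.move i t h.1 h.2).ne'⟩
  by_contra hc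
  exact h (letter_fix (S := S) (c := (i, true)) hc)

lemma mem_supt_g (c : ι × Bool) : t ∈ supt (S.g c.1) ↔ S.Moves c t := by rw [supt_g]; rfl

lemma supt_letter (c : ι × Bool) : supt (S.letter c) = supt (S.g c.1) := by
  rcases c with ⟨i, b⟩
  cases b
  · exact supt_inv _
  · rfl

lemma lo_lt_hi_supt (S : FastSystem r) (i : ι) : S.lo (r (i, false)) < S.hi (r (i, true)) :=
  (S.lo_lt_hi _).trans_le (le_hi (S.src_lt_dest i).le)

lemma isPosBump_g (S : FastSystem r) (i : ι) : IsPosBump (S.g i) := by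
  refine ⟨⟨(S.mono i).monotone, ?_⟩, fun t ht => ?_⟩
  · rw [supt_g]; exact isConnected_Ioo (S.lo_lt_hi_supt i)
  · rw [supt_g] at ht; exact S.move i t ht.1 ht.2

lemma isBump_letter (c : ι × Bool) : IsBump (S.letter c) := by
  rcases c with ⟨i, b⟩
  cases b
  · exact (S.isPosBump_g i).1.inv
  · exact (S.isPosBump_g i).1

lemma isPosBump_letter_iff (c : ι × Bool) : IsPosBump (S.letter c) ↔ c.2 = true := by
  rcases c with ⟨i, b⟩
  cases b
  · exact iff_of_false (S.isPosBump_g i).not_inv (by simp)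
  · exact iff_of_true (S.isPosBump_g i) rfl

lemma lEnd_g (S : FastSystem r) (i : ι) : lEnd (S.g i) = S.lo (r (i, false)) := by
  rw [lEnd, supt_g, csInf_Ioo (S.lo_lt_hi_supt i)]

lemma g_injective (S : FastSystem r) : Function.Injective S.g := by
  intro i k h
  have h1 : S.lo (r (i, false)) = S.lo (r (k, false)) := by rw [← lEnd_g, ← lEnd_g, h]
  have h2 : r (i, false) = r (k, false) :=
    le_antisymm (lt_of_lo_lt_hi (S := S) (by rw [h1]; exact S.lo_lt_hi _))
      (lt_of_lo_lt_hi (S := S) (by rw [← h1]; exact S.lo_lt_hi _))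
  exact congrArg Prod.fst (S.inj h2)

lemma bump_injective : Function.Injective (S.bump C) := by
  intro i k h
  refine S.g_injective ?_
  have h0 := isPosBump_letter_iff (S := S) (i, C.sign i)
  have h1 := isPosBump_letter_iff (S := S) (k, C.sign k)
  change S.letter _ = S.letter _ at h
  rw [h, h1] at h0
  simp only [Bool.coe_iff_coe] at h0
  rw [h0] at h
  cases hs : C.sign i <;> simpa [hs, letter] using h

lemma not_moves_of_ne (hik : i ≠ k) (ho : C.owner i = C.owner k) {b b' : Bool}
    (hi : S.Moves (i, b) t) : ¬ S.Moves (k, b') t := by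
  intro hk
  rcases C.sep i k hik ho with h | h
  · exact absurd (hi.2.trans_le (S.hi_le_lo _ _ h)) hk.1.not_gt
  · exact absurd (hk.2.trans_le (S.hi_le_lo _ _ h)) hi.1.not_gt

lemma act_map_eq_self {L : List ι} (h : ∀ i ∈ L, ¬ S.Moves (i, C.sign i) t) :
    S.act (L.map fun i => (i, C.sign i)) t = t := by
  induction L with
  | nil => rfl
  | cons i L ih =>
    rw [List.map_cons, act_cons, ih fun k hk => h k (List.mem_cons_of_mem _ hk)]
    exact letter_fix (h i List.mem_cons_self)

lemma act_map_eq_bump {L : List ι} (hn : L.Nodup) (hL : ∀ k ∈ L, C.owner k = C.owner i)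
    (hi : i ∈ L) (ht : S.Moves (i, C.sign i) t) :
    S.act (L.map fun i => (i, C.sign i)) t = S.bump C i t := by
  induction L with
  | nil => simp at hi
  | cons k L ih =>
    rw [List.map_cons, act_cons]
    rw [List.nodup_cons] at hn
    have hL' : ∀ l ∈ L, C.owner l = C.owner i := fun l hl => hL l (List.mem_cons_of_mem _ hl)
    by_cases hik : i = k
    · subst hik
      rw [act_map_eq_self fun l hl => not_moves_of_ne
        (show i ≠ l from fun h => hn.1 (h ▸ hl)) (hL' l hl).symm ht]
      rfl
    · rw [ih hn.2 hL' ((List.mem_cons.1 hi).resolve_left hik)]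
      exact letter_fix (not_moves_of_ne (b := C.sign i) hik (hL k List.mem_cons_self).symm
        (ht.letter (d := (i, C.sign i)) rfl))

variable [Fintype ι]

lemma elt_of_mem (ht : t ∈ supt (S.g i)) : S.elt C (C.owner i) t = S.bump C i t := by
  rw [elt, Assembly.word, rep_mk]
  refine act_map_eq_bump (Finset.nodup_toList _) (fun k hk => ?_) ?_ ?_
  · simpa using hk
  · simp
  · exact (mem_supt_g (i, C.sign i)).1 ht

lemma elt_of_notMem (h : ∀ i, C.owner i = j → t ∉ supt (S.g i)) : S.elt C j t = t := by
  rw [elt, Assembly.word, rep_mk]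
  refine act_map_eq_self fun i hi h1 => h i ?_ ((mem_supt_g (i, C.sign i)).2 h1)
  simpa using hi

lemma exists_of_elt_ne (h : S.elt C j t ≠ t) : ∃ i, C.owner i = j ∧ t ∈ supt (S.g i) := by
  by_contra! hc
  exact h (elt_of_notMem hc)

lemma elt_isOPH (S : FastSystem r) (j : J) : IsOPH (S.elt C j) := by
  rw [elt, Assembly.word, rep_mk]
  exact (strictMono_act _).monotone

lemma usedIn_elt (i : ι) : UsedIn (S.elt C (C.owner i)) (S.g i) := by
  refine ⟨S.isPosBump_g i, ?_⟩
  cases hs : C.sign i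
  · exact Or.inr fun t ht => (elt_of_mem ht).trans (by simp [bump, letter, hs])
  · exact Or.inl fun t ht => (elt_of_mem ht).trans (by simp [bump, letter, hs])

lemma usedIn_elt_iff : UsedIn (S.elt C j) a ↔ ∃ i, C.owner i = j ∧ S.g i = a := by
  constructor
  · intro h
    obtain ⟨t, ht⟩ := h.1.1.2.nonempty
    obtain ⟨i, hi, hit⟩ := exists_of_elt_ne (h.ne ht)
    exact ⟨i, hi, UsedIn.eq (S.elt_isOPH j) (hi ▸ usedIn_elt i) h hit ht⟩
  · rintro ⟨i, rfl, rfl⟩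
    exact usedIn_elt i

lemma mem_signedBumps_elt_iff {b : Homeo01} :
    b ∈ signedBumps (S.elt C j) ↔ ∃ i, C.owner i = j ∧ S.bump C i = b := by
  constructor
  · intro h
    obtain ⟨a, hb, ha⟩ : ∃ a, supt b = supt a ∧ UsedIn (S.elt C j) a := by
      rcases signedBumps_cases h with h | h
      · exact ⟨b, rfl, h.2⟩
      · exact ⟨b⁻¹, (supt_inv b).symm, h.2⟩
    obtain ⟨i, rfl, rfl⟩ := usedIn_elt_iff.1 ha
    refine ⟨i, rfl, ?_⟩
    ext1 t
    by_cases ht : t ∈ supt (S.g i)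
    · rw [h.2 (hb ▸ ht), elt_of_mem ht]
    · have h1 : t ∉ supt b := hb ▸ ht
      have h2 : t ∉ supt (S.bump C i) := by rwa [bump, supt_letter]
      rw [not_not.1 h1, not_not.1 h2]
  · rintro ⟨i, rfl, rfl⟩
    refine ⟨isBump_letter _, fun t ht => (elt_of_mem ?_).symm⟩
    rwa [bump, supt_letter] at ht

lemma eq_elt (hf : IsOPH f) (h1 : ∀ a, UsedIn f a → ∃ i, C.owner i = j ∧ S.g i = a)
    (h2 : ∀ i, C.owner i = j → EqOn f (S.bump C i) (supt (S.g i))) : f = S.elt C j := by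
  ext1 t
  by_cases ht : ∃ i, C.owner i = j ∧ t ∈ supt (S.g i)
  · obtain ⟨i, rfl, hi⟩ := ht
    rw [h2 i rfl hi, elt_of_mem hi]
  · push Not at ht
    rw [elt_of_notMem ht]
    by_contra hft
    obtain ⟨a, ha, hta⟩ := hf.exists_usedIn hft
    obtain ⟨i, hi, rfl⟩ := h1 a ha
    exact ht i hi hta

lemma usedBumps_range : usedBumps (range (S.elt C)) = range S.g := by
  ext a
  constructor
  · rintro ⟨-, ⟨j, rfl⟩, ha⟩
    obtain ⟨i, -, h⟩ := usedIn_elt_iff.1 ha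
    exact ⟨i, h⟩
  · rintro ⟨i, rfl⟩
    exact ⟨_, ⟨_, rfl⟩, usedIn_elt (C := C) i⟩

end FastSystem

end Assembly

/-! ### Feet of a fast system -/

namespace FastSystem

variable {ι : Type*} {N : ℕ} {r : ι × Bool → Fin N} {J : Type*} {S : FastSystem r}
  {C : Assembly r J} {m : Homeo01 → UI} {c d : ι × Bool}

lemma mem_zone_of_Ioo {t : UI} (h1 : S.lo (r c) < t) (h2 : t < S.hi (r c)) : t ∈ S.zone c :=
  ⟨h1.le, h2, fun _ => h1⟩

lemma zone_nonempty (S : FastSystem r) (c : ι × Bool) : (S.zone c).Nonempty := by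
  obtain ⟨t, h1, h2⟩ := exists_between (S.lo_lt_hi (r c))
  exact ⟨t, mem_zone_of_Ioo h1 h2⟩

lemma zone_injective (S : FastSystem r) : Function.Injective S.zone := by
  intro c d h
  obtain ⟨t, ht⟩ := S.zone_nonempty c
  exact zone_unique ht (h ▸ ht)

lemma zone_lt_zone_iff : (∀ s ∈ S.zone c, ∀ t ∈ S.zone d, s < t) ↔ r c < r d := by
  constructor
  · intro h
    obtain ⟨s, hs⟩ := S.zone_nonempty c
    obtain ⟨t, ht⟩ := S.zone_nonempty d
    have hst := h s hs t ht
    refine (lt_of_lo_lt_hi ((hs.1.trans_lt hst).trans ht.2.1)).lt_of_ne fun hcd => ?_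
    rw [S.inj hcd] at h hs
    exact lt_irrefl s (h s hs s hs)
  · intro h s hs t ht
    exact hs.2.1.trans_le ((S.hi_le_lo _ _ h).trans ht.1)

lemma foot_g (hm : ∀ i, m (S.g i) = S.hi (r (i, false)))
    (c : ι × Bool) : foot (S.g c.1) (m (S.g c.1)) c.2 = S.zone c := by
  ext t
  rcases c with ⟨i, b⟩
  have h1 := S.src_lt_dest i
  have h2 := le_hi (S := S) h1.le
  have h3 := (S.lo_lt_hi (r (i, false))).trans_le (S.hi_le_lo _ _ h1)
  cases b
  · simp only [foot, src, supt_g, hm, zone, mem_ofPred_eq, mem_Ioo, forall_const]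
    exact ⟨fun h => ⟨h.1.1.le, h.2, h.1.1⟩, fun h => ⟨⟨h.2.2, h.2.1.trans_le h2⟩, h.2.1⟩⟩
  · simp only [foot, dest, supt_g, hm, S.mark, zone, mem_ofPred_eq, mem_Ioo, reduceCtorEq,
      IsEmpty.forall_iff, and_true]
    exact ⟨fun h => ⟨h.2, h.1.2⟩, fun h => ⟨⟨h3.trans_le h.1, h.2⟩, h.1⟩⟩

lemma isMarking_range (hm : ∀ i, m (S.g i) = S.hi (r (i, false))) : IsMarking (range S.g) m := by
  rintro - ⟨i, rfl⟩
  rw [hm, supt_g]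
  exact ⟨S.lo_lt_hi _, (S.hi_le_lo _ _ (S.src_lt_dest i)).trans_lt (S.lo_lt_hi _)⟩

lemma feetDisjoint_range (hm : ∀ i, m (S.g i) = S.hi (r (i, false))) :
    FeetDisjoint (range S.g) m := by
  rintro - ⟨i, rfl⟩ - ⟨k, rfl⟩ b b' h
  rw [foot_g hm (i, b), foot_g hm (k, b'), Set.disjoint_left]
  rintro t h1 h2
  have := zone_unique h1 h2
  rw [Prod.mk.injEq] at this
  exact h (by rw [this.1, this.2])

lemma feet_range [Fintype ι] (hm : ∀ i, m (S.g i) = S.hi (r (i, false))) :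
    Feet (range (S.elt C)) m = range S.zone := by
  ext F
  simp only [Feet, usedBumps_range, mem_ofPred_eq, exists_range_iff]
  constructor
  · rintro ⟨i, rfl | rfl⟩
    · exact ⟨(i, false), (foot_g hm (i, false)).symm⟩
    · exact ⟨(i, true), (foot_g hm (i, true)).symm⟩
  · rintro ⟨⟨i, b⟩, rfl⟩
    refine ⟨i, ?_⟩
    cases b
    · exact Or.inl (foot_g hm (i, false)).symm
    · exact Or.inr (foot_g hm (i, true)).symm

lemma sDest_letter (hm : ∀ i, m (S.g i) = S.hi (r (i, false)))
    (c : ι × Bool) : sDest m (S.letter c) = S.zone c := by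
  rw [sDest, isPosBump_letter_iff]
  rcases c with ⟨i, b⟩
  cases b
  · simpa [letter, foot, flip] using foot_g hm (i, false)
  · simpa [letter, foot, flip] using foot_g hm (i, true)

lemma sSrc_letter (hm : ∀ i, m (S.g i) = S.hi (r (i, false)))
    (c : ι × Bool) : sSrc m (S.letter c) = S.zone (flip c) := by
  rw [sSrc, isPosBump_letter_iff]
  rcases c with ⟨i, b⟩
  cases b
  · simpa [letter, foot, flip] using foot_g hm (i, true)
  · simpa [letter, foot, flip] using foot_g hm (i, false)

end FastSystem

/-- The family of bumps used in a geometrically fast set. -/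
def usedMarkedBumps {X : Set Homeo01} {m : Homeo01 → UI} (hm : IsMarking (usedBumps X) m)
    (hfd : FeetDisjoint (usedBumps X) m) : MarkedBumps (usedBumps X) where
  g i := i
  m i := m i
  pos i := i.2.choose_spec.2.1
  mem i := hm i i.2
  disj c d h := hfd _ c.1.2 _ d.1.2 _ _ fun h1 => h <| by
    rw [Prod.mk.injEq] at h1
    exact Prod.ext (Subtype.ext h1.1) h1.2

lemma finite_usedBumps {X : Set Homeo01} {m : Homeo01 → UI} (hX : ∀ f ∈ X, IsOPH f)
    (hm : IsMarking (usedBumps X) m) (hfd : FeetDisjoint (usedBumps X) m)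
    (htr : (transitionPoints X).Finite) : (usedBumps X).Finite := by
  refine Set.Finite.of_finite_image (f := lEnd) (htr.subset ?_) ?_
  · rintro - ⟨a, ⟨f, hf, ha⟩, rfl⟩
    exact ⟨f, hf, Or.inl (ha.isLeftTransition (hX f hf))⟩
  · intro a ha b hb hab
    have := (usedMarkedBumps hm hfd).fl_injective
      (a₁ := (⟨a, ha⟩, false)) (a₂ := (⟨b, hb⟩, false)) hab
    exact congrArg (fun c : usedBumps X × Bool => (c.1 : Homeo01)) this

/-- Every geometrically fast set with finitely many transition points is given by a fast system. -/
theorem exists_presentation {X : Set Homeo01} {m : Homeo01 → UI} (hX : ∀ f ∈ X, IsOPH f)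
    (hprop : GeomProper X) (hm : IsMarking (usedBumps X) m) (hfd : FeetDisjoint (usedBumps X) m)
    (htr : (transitionPoints X).Finite) :
    ∃ (ι : Type) (_ : Fintype ι) (N : ℕ) (r : ι × Bool → Fin N) (C : Assembly r X)
      (S : FastSystem r), MarkedBumps.IsRanking r ∧ (∀ j : X, S.elt C j = j) ∧
        ∀ i, m (S.g i) = S.hi (r (i, false)) := by
  classical
  have hfin := finite_usedBumps hX hm hfd htr
  have := hfin.fintype
  let B := usedMarkedBumps hm hfd
  obtain ⟨N, r, hr, ho⟩ := B.exists_isRanking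
  obtain ⟨S, hg, hS⟩ := ho.exists_fastSystem hr
  have hg' : ∀ i, S.g i = i := fun i => congrFun hg i
  have hown : ∀ i : usedBumps X, ∃ f : X, UsedIn f i := fun i => by
    obtain ⟨f, hf, h⟩ := i.2
    exact ⟨⟨f, hf⟩, h⟩
  choose owner howner using hown
  have hsep : ∀ i k, i ≠ k → owner i = owner k →
      r (i, true) < r (k, false) ∨ r (k, true) < r (i, false) := by
    intro i k hik ho'
    by_contra! hc
    have h1 : r (k, false) < r (i, true) := hc.1.lt_of_ne fun h => by simpa using hr.inj h
    have h2 : r (i, false) < r (k, true) := hc.2.lt_of_ne fun h => by simpa using hr.inj h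
    have h3 : S.lo (r (k, false)) < S.hi (r (i, true)) :=
      (S.lo_lt_hi _).trans_le (FastSystem.le_hi h1.le)
    have h4 : S.lo (r (i, false)) < S.hi (r (k, true)) :=
      (S.lo_lt_hi _).trans_le (FastSystem.le_hi h2.le)
    obtain ⟨t, ht1, ht2⟩ := exists_between
      (max_lt (lt_min (S.lo_lt_hi_supt i) h4) (lt_min h3 (S.lo_lt_hi_supt k)))
    rw [max_lt_iff] at ht1
    rw [lt_min_iff] at ht2
    refine hik (Subtype.ext ((howner i).eq (hX _ (owner i).2) (ho' ▸ howner k) (t := t) ?_ ?_))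
    · rw [← hg', S.supt_g]; exact ⟨ht1.1, ht2.1⟩
    · rw [← hg', S.supt_g]; exact ⟨ht1.2, ht2.2⟩
  let C : Assembly r X := ⟨owner, fun i => decide (EqOn (owner i : Homeo01) i (supt i)), hsep⟩
  refine ⟨_, this, N, r, C, S, hr, fun j => ?_, fun i => ?_⟩
  · refine (FastSystem.eq_elt (hX j j.2) (fun a ha => ?_) fun i hi => ?_).symm
    · refine ⟨⟨a, j, j.2, ha⟩, ?_, hg' _⟩
      by_contra hne
      have ha' := howner ⟨a, j, j.2, ha⟩
      exact hprop.1 _ (owner ⟨a, j, j.2, ha⟩).2 _ j.2 (fun h => hne (Subtype.ext h)) (lEnd a)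
        ⟨ha'.isLeftTransition (hX _ (owner _).2), ha.isLeftTransition (hX j j.2)⟩
    · rw [hg']
      change owner i = j at hi
      subst hi
      by_cases h : EqOn (owner i : Homeo01) i (supt i)
      · have : S.bump C i = i := by simp [FastSystem.bump, FastSystem.letter, C, h, hg']
        rwa [this]
      · have : S.bump C i = (i : Homeo01)⁻¹ := by
          simp [FastSystem.bump, FastSystem.letter, C, h, hg']
        rw [this]
        exact (howner i).2.resolve_left h
  · rw [hg', (hS _).2]; rfl

/-! ### Isomorphisms of dynamical diagrams -/

lemma bijOn_range {α β K : Type*} {u : K → α} {v : K → β} {w : α → β}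
    (hv : Function.Injective v) (h : ∀ k, w (u k) = v k) : BijOn w (range u) (range v) := by
  refine ⟨?_, ?_, ?_⟩
  · rintro - ⟨k, rfl⟩
    exact ⟨k, (h k).symm⟩
  · rintro - ⟨k, rfl⟩ - ⟨l, rfl⟩ hkl
    rw [h, h] at hkl
    rw [hv hkl]
  · rintro - ⟨k, rfl⟩
    exact ⟨u k, ⟨k, rfl⟩, h k⟩

namespace FastSystem

variable {ι : Type*} [Fintype ι] {N : ℕ} {r : ι × Bool → Fin N} {J : Type*}
  {S T : FastSystem r} {C : Assembly r J} {m m' : Homeo01 → UI}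

/-- Fast systems with the same combinatorial data have isomorphic dynamical diagrams. -/
theorem exists_diagIso (hm : ∀ i, m (S.g i) = S.hi (r (i, false)))
    (hm' : ∀ i, m' (T.g i) = T.hi (r (i, false)))
    (hS : Function.Injective (S.elt C)) (hT : Function.Injective (T.elt C)) :
    ∃ τ, DiagIso (range (S.elt C)) m (range (T.elt C)) m' τ := by
  classical
  let τ : Homeo01 → Homeo01 := Function.extend (S.elt C) (T.elt C) id
  have hτ : ∀ j, τ (S.elt C j) = T.elt C j := hS.extend_apply _ _
  let Φ : Set UI → Set UI := Function.extend S.zone T.zone id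
  have hΦ : ∀ c, Φ (S.zone c) = T.zone c := S.zone_injective.extend_apply _ _
  let β : Homeo01 → Homeo01 := Function.extend (S.bump C) (T.bump C) id
  have hβ : ∀ i, β (S.bump C i) = T.bump C i := bump_injective.extend_apply _ _
  refine ⟨τ, bijOn_range hT hτ, Φ, ?_, ?_, ?_⟩
  · rw [feet_range hm, feet_range hm']
    exact bijOn_range T.zone_injective hΦ
  · rw [feet_range hm]
    rintro - ⟨c, rfl⟩ - ⟨d, rfl⟩ h
    rw [hΦ, hΦ]
    exact zone_lt_zone_iff.2 (zone_lt_zone_iff.1 h)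
  · rintro - ⟨j, rfl⟩
    refine ⟨β, ?_, ?_⟩
    · have h1 : ∀ R : FastSystem r, signedBumps (R.elt C j) =
          range fun i : {i // C.owner i = j} => R.bump C i := by
        intro R
        ext b
        rw [mem_signedBumps_elt_iff]
        simp
      rw [hτ, h1, h1]
      exact bijOn_range
        ((bump_injective (S := T) (C := C)).comp Subtype.val_injective) fun i => hβ i
    · intro b hb
      obtain ⟨i, -, rfl⟩ := mem_signedBumps_elt_iff.1 hb
      rw [hβ, bump, bump, sSrc_letter hm, sSrc_letter hm', sDest_letter hm, sDest_letter hm']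
      exact ⟨hΦ _, hΦ _⟩

/-- A set with the dynamical diagram of a fast system is given by a fast system with the same
combinatorial data. -/
theorem exists_of_diagIso (hr : MarkedBumps.IsRanking r)
    (hm' : ∀ i, m' (T.g i) = T.hi (r (i, false))) {X : Set Homeo01} {τ : Homeo01 → Homeo01}
    (hX : ∀ f ∈ X, IsOPH f) (hm : IsMarking (usedBumps X) m) (hfd : FeetDisjoint (usedBumps X) m)
    (h : DiagIso X m (range (T.elt C)) m' τ) :
    ∃ S : FastSystem r, X = range (S.elt C) ∧ ∀ j, τ (S.elt C j) = T.elt C j := by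
  classical
  obtain ⟨hτ, Φ, -, hΦlt, hβ⟩ := h
  have hf : ∀ j, ∃ f ∈ X, τ f = T.elt C j := fun j => hτ.surjOn ⟨j, rfl⟩
  choose f hfX hfτ using hf
  choose β hβ hβΦ using fun j => hβ (f j) (hfX j)
  have hb : ∀ i, ∃ b ∈ signedBumps (f (C.owner i)), β (C.owner i) b = T.bump C i := fun i =>
    (hβ (C.owner i)).surjOn (by rw [hfτ]; exact mem_signedBumps_elt_iff.2 ⟨i, rfl, rfl⟩)
  choose b hbf hbT using hb
  have hΦ : ∀ i, Φ (sSrc m (b i)) = T.zone (i, !C.sign i) ∧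
      Φ (sDest m (b i)) = T.zone (i, C.sign i) := by
    intro i
    have h1 := hβΦ _ _ (hbf i)
    rwa [hbT, bump, sSrc_letter hm', sDest_letter hm'] at h1
  let a : ι → Homeo01 := fun i => if IsPosBump (b i) then b i else (b i)⁻¹
  have haf : ∀ i, UsedIn (f (C.owner i)) (a i) := by
    intro i
    by_cases hp : IsPosBump (b i)
    · rcases signedBumps_cases (hbf i) with h1 | h1
      · simpa [a, hp] using h1.2
      · exact absurd hp h1.1
    · rcases signedBumps_cases (hbf i) with h1 | h1
      · exact absurd h1.1 hp
      · simpa [a, hp] using h1.2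
  have haX : ∀ i, a i ∈ usedBumps X := fun i => ⟨_, hfX _, haf i⟩
  have hfeet : ∀ i c, foot (a i) (m (a i)) c ∈ Feet X m := fun i c =>
    ⟨a i, haX i, by cases c <;> simp [foot]⟩
  have hlt : ∀ i, ∀ s ∈ foot (a i) (m (a i)) false, ∀ t ∈ foot (a i) (m (a i)) true, s < t :=
    fun i s hs t ht => hs.2.trans (((haf i).1.2 _ (hm _ (haX i))).trans_le ht.2)
  have hsign : ∀ i, (IsPosBump (b i) ↔ C.sign i = true) ∧
      ∀ c, Φ (foot (a i) (m (a i)) c) = T.zone (i, c) := by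
    intro i
    have h1 := hΦlt _ (hfeet i false) _ (hfeet i true) (hlt i)
    have h2 := hΦ i
    by_cases hp : IsPosBump (b i)
    · have h3 : a i = b i := if_pos hp
      rw [sSrc, sDest, if_pos hp, if_pos hp, ← h3] at h2
      simp only [foot] at h1
      rw [h2.1, h2.2, zone_lt_zone_iff] at h1
      cases hs : C.sign i
      · rw [hs] at h1
        exact absurd h1 (T.src_lt_dest i).not_gt
      · rw [hs] at h2
        refine ⟨iff_of_true hp rfl, fun c => ?_⟩
        cases c
        · exact h2.1
        · exact h2.2
    · have h3 : a i = (b i)⁻¹ := if_neg hp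
      rw [sSrc, sDest, if_neg hp, if_neg hp, ← h3] at h2
      simp only [foot] at h1
      rw [h2.1, h2.2, zone_lt_zone_iff] at h1
      cases hs : C.sign i
      · rw [hs] at h2
        refine ⟨iff_of_false hp (by simp), fun c => ?_⟩
        cases c
        · exact h2.2
        · exact h2.1
      · rw [hs] at h1
        exact absurd h1 (T.src_lt_dest i).not_gt
  let B : MarkedBumps ι :=
    { g := a
      m := fun i => m (a i)
      pos := fun i => (haf i).1
      mem := fun i => hm _ (haX i)
      disj := fun c d hcd => hfd _ (haX _) _ (haX _) _ _ fun h1 => hcd <| by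
        rw [Prod.mk.injEq] at h1
        have h2 := (hsign c.1).2 c.2
        rw [h1.1, h1.2, (hsign d.1).2 d.2] at h2
        exact Prod.ext (congrArg Prod.fst (T.zone_injective h2)).symm h1.2 }
  have ho : B.IsOrderedBy r := by
    intro c d hcd
    refine (B.fh_le_fl_or fun h1 => hcd.ne (congrArg r h1)).resolve_right fun h1 => ?_
    have h2 := hΦlt _ (hfeet d.1 d.2) _ (hfeet c.1 c.2) fun s hs t ht =>
      (B.mem_foot.1 hs).2.1.trans_le (h1.trans (B.mem_foot.1 ht).1)
    rw [(hsign _).2, (hsign _).2, zone_lt_zone_iff] at h2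
    exact lt_asymm hcd h2
  obtain ⟨S, hg, -⟩ := ho.exists_fastSystem hr
  have hg' : ∀ i, S.g i = a i := fun i => congrFun hg i
  have hbump : ∀ i, S.bump C i = b i := by
    intro i
    have h1 := (hsign i).1
    cases hs : C.sign i
    · have h2 : ¬ IsPosBump (b i) := by simp [h1, hs]
      simp [bump, letter, hs, hg', a, h2]
    · have h2 : IsPosBump (b i) := h1.2 hs
      simp [bump, letter, hs, hg', a, h2]
  have hfe : ∀ j, f j = S.elt C j := by
    intro j
    refine eq_elt (hX _ (hfX j)) (fun a' ha' => ?_) fun i hi => ?_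
    · obtain ⟨b', hb', hab⟩ : ∃ b' ∈ signedBumps (f j), (b' = a' ∨ b' = a'⁻¹) := by
        rcases ha'.2 with h1 | h1
        · exact ⟨a', ⟨ha'.1.1, h1.symm⟩, Or.inl rfl⟩
        · refine ⟨a'⁻¹, ⟨ha'.1.1.inv, ?_⟩, Or.inr rfl⟩
          rw [supt_inv]
          exact h1.symm
      have h1 := (hβ j).mapsTo hb'
      rw [hfτ, mem_signedBumps_elt_iff] at h1
      obtain ⟨i, rfl, h1⟩ := h1
      rw [← hbT] at h1
      have h2 := (hβ _).injOn (hbf i) hb' h1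
      refine ⟨i, rfl, ?_⟩
      rw [hg']
      rcases hab with rfl | rfl
      · simp [a, h2, ha'.1]
      · simp [a, h2, ha'.1.not_inv]
    · subst hi
      have h1 : supt (S.g i) = supt (b i) := by rw [← hbump, bump, supt_letter]
      rw [hbump, h1]
      exact (hbf i).2.symm
  refine ⟨S, ?_, fun j => by rw [← hfe, hfτ]⟩
  ext x
  constructor
  · intro hx
    obtain ⟨j, hj⟩ := hτ.mapsTo hx
    exact ⟨j, (hfe j).symm.trans (hτ.injOn (hfX j) hx ((hfτ j).trans hj))⟩
  · rintro ⟨j, rfl⟩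
    exact hfe j ▸ hfX j

end FastSystem

/-! ### Transition points of the elements of an assembly -/

namespace FastSystem

variable {ι : Type*} {N : ℕ} {r : ι × Bool → Fin N} {J : Type*}
  {S : FastSystem r} {C : Assembly r J} {i : ι} {j : J} {t : UI}

lemma lo_injective (S : FastSystem r) : Function.Injective S.lo := fun k l h =>
  le_antisymm (lt_of_lo_lt_hi (S := S) (by rw [h]; exact S.lo_lt_hi _))
    (lt_of_lo_lt_hi (S := S) (by rw [← h]; exact S.lo_lt_hi _))

lemma hi_injective (S : FastSystem r) : Function.Injective S.hi := fun k l h =>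
  le_antisymm (lt_of_lo_lt_hi (S := S) (by rw [← h]; exact S.lo_lt_hi _))
    (lt_of_lo_lt_hi (S := S) (by rw [h]; exact S.lo_lt_hi _))

variable [Fintype ι]

lemma exists_of_isLeftTransition (h : IsLeftTransition (S.elt C j) t) :
    ∃ i, C.owner i = j ∧ t = S.lo (r (i, false)) := by
  by_contra! hc
  have hev : ∀ᶠ ε in nhdsWithin (0 : ℝ) (Ioi 0), ∀ i, t < S.lo (r (i, false)) →
      (t : ℝ) + ε < S.lo (r (i, false)) := by
    refine Filter.eventually_all.2 fun i => ?_
    by_cases hi : t < S.lo (r (i, false))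
    · have hi' : (0 : ℝ) < S.lo (r (i, false)) - t := sub_pos.2 hi
      filter_upwards [Ioo_mem_nhdsGT hi'] with ε hε _
      linarith [hε.2]
    · exact Filter.Eventually.of_forall fun _ h1 => absurd h1 hi
  obtain ⟨ε, hε, hε0⟩ := (hev.and self_mem_nhdsWithin).exists
  obtain ⟨s, hs, hts, hsε⟩ := h.2 ε hε0
  obtain ⟨i, rfl, hi⟩ := exists_of_elt_ne hs
  rw [supt_g] at hi
  have h1 : t ∉ supt (S.g i) := fun ht => h.1 ((usedIn_elt i).ne ht)
  rw [supt_g] at h1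
  have h2 : t ≤ S.lo (r (i, false)) := by
    by_contra! h2
    exact h1 ⟨h2, hts.trans hi.2⟩
  have h3 := hε i (h2.lt_of_ne (hc i rfl))
  have h4 : (S.lo (r (i, false)) : ℝ) < s := hi.1
  linarith

lemma exists_of_isRightTransition (h : IsRightTransition (S.elt C j) t) :
    ∃ i, C.owner i = j ∧ t = S.hi (r (i, true)) := by
  by_contra! hc
  have hev : ∀ᶠ ε in nhdsWithin (0 : ℝ) (Ioi 0), ∀ i, S.hi (r (i, true)) < t →
      (S.hi (r (i, true)) : ℝ) < t - ε := by
    refine Filter.eventually_all.2 fun i => ?_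
    by_cases hi : S.hi (r (i, true)) < t
    · have hi' : (0 : ℝ) < t - S.hi (r (i, true)) := sub_pos.2 hi
      filter_upwards [Ioo_mem_nhdsGT hi'] with ε hε _
      linarith [hε.2]
    · exact Filter.Eventually.of_forall fun _ h1 => absurd h1 hi
  obtain ⟨ε, hε, hε0⟩ := (hev.and self_mem_nhdsWithin).exists
  obtain ⟨s, hs, hts, hsε⟩ := h.2 ε hε0
  obtain ⟨i, rfl, hi⟩ := exists_of_elt_ne hs
  rw [supt_g] at hi
  have h1 : t ∉ supt (S.g i) := fun ht => h.1 ((usedIn_elt i).ne ht)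
  rw [supt_g] at h1
  have h2 : S.hi (r (i, true)) ≤ t := by
    by_contra! h2
    exact h1 ⟨hi.1.trans hts, h2⟩
  have h3 := hε i (h2.lt_of_ne (hc i rfl).symm)
  have h4 : (s : ℝ) < S.hi (r (i, true)) := hi.2
  linarith

lemma geomProper_range (S : FastSystem r) : GeomProper (range (S.elt C)) := by
  constructor
  · rintro - ⟨j, rfl⟩ - ⟨k, rfl⟩ hjk t ⟨h1, h2⟩
    obtain ⟨i, rfl, rfl⟩ := exists_of_isLeftTransition h1
    obtain ⟨l, rfl, h⟩ := exists_of_isLeftTransition h2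
    obtain rfl : i = l := congrArg Prod.fst (S.inj (S.lo_injective h))
    exact hjk rfl
  · rintro - ⟨j, rfl⟩ - ⟨k, rfl⟩ hjk t ⟨h1, h2⟩
    obtain ⟨i, rfl, rfl⟩ := exists_of_isRightTransition h1
    obtain ⟨l, rfl, h⟩ := exists_of_isRightTransition h2
    obtain rfl : i = l := congrArg Prod.fst (S.inj (S.hi_injective h))
    exact hjk rfl

lemma finite_transitionPoints_range (S : FastSystem r) :
    (transitionPoints (range (S.elt C))).Finite := by
  refine ((finite_range S.lo).union (finite_range S.hi)).subset ?_
  rintro t ⟨-, ⟨j, rfl⟩, h | h⟩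
  · obtain ⟨i, -, rfl⟩ := exists_of_isLeftTransition h
    exact Or.inl ⟨_, rfl⟩
  · obtain ⟨i, -, rfl⟩ := exists_of_isRightTransition h
    exact Or.inr ⟨_, rfl⟩

lemma elt_eq_bump_of_mem_Icc (h1 : S.lo (r (i, false)) ≤ t) (h2 : t ≤ S.hi (r (i, true))) :
    S.elt C (C.owner i) t = S.bump C i t := by
  by_cases ht : t ∈ supt (S.g i)
  · exact elt_of_mem ht
  · have h3 : S.bump C i t = t := letter_fix fun h => ht ((mem_supt_g (i, C.sign i)).2 h)
    rw [h3]
    refine elt_of_notMem fun k hk htk => ?_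
    have hik : i ≠ k := by
      rintro rfl
      exact ht htk
    rw [supt_g] at htk
    rcases C.sep i k hik hk.symm with h | h
    · exact absurd (h2.trans (S.hi_le_lo _ _ h)) (not_le.2 htk.1)
    · exact absurd ((S.hi_le_lo _ _ h).trans h1) (not_le.2 htk.2)

lemma elt_eqOn_Icc (k : Fin N) : (∀ t, S.lo k ≤ t → t ≤ S.hi k → S.elt C j t = t) ∨
    ∃ i, r (i, false) ≤ k ∧ k ≤ r (i, true) ∧
      ∀ t, S.lo k ≤ t → t ≤ S.hi k → S.elt C j t = S.bump C i t := by
  by_cases hk : ∃ i, C.owner i = j ∧ r (i, false) ≤ k ∧ k ≤ r (i, true)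
  · obtain ⟨i, rfl, h1, h2⟩ := hk
    exact Or.inr ⟨i, h1, h2, fun t ht1 ht2 =>
      elt_eq_bump_of_mem_Icc ((le_lo h1).trans ht1) (ht2.trans (le_hi h2))⟩
  · refine Or.inl fun t ht1 ht2 => elt_of_notMem fun i hi hti => hk ⟨i, hi, ?_⟩
    rw [supt_g] at hti
    exact ⟨lt_of_lo_lt_hi (hti.1.trans_le ht2), lt_of_lo_lt_hi (ht1.trans_lt hti.2)⟩

end FastSystem

/-! ### Piecewise linearity of the model -/

lemma modelBump_affine {N s d k : ℕ} (h : s + 1 < d) (hd : d < N) (hsk : s ≤ k) (hkd : k ≤ d) :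
    ∃ c e : ℝ, ∀ t : UI, (k : ℝ) / N ≤ t → (t : ℝ) ≤ ((k : ℝ) + 1) / N →
      (modelBump N s d h hd t : ℝ) = c * t + e := by
  rcases hsk.eq_or_lt with rfl | hsk
  · refine ⟨(d : ℝ) - s, (s : ℝ) / N - ((d : ℝ) - s) * ((s : ℝ) / N), fun t h1 h2 => ?_⟩
    rw [modelBump_src h1 h2]
    ring
  · have h3 : ((s : ℝ) + 1) / N ≤ (k : ℝ) / N := by gcongr; exact_mod_cast hsk
    have h4 : ((k : ℝ) + 1) / N ≤ ((d : ℝ) + 1) / N := by gcongr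
    refine ⟨((d : ℝ) - s)⁻¹, ((d : ℝ) + 1) / N - ((d : ℝ) + 1) / N / ((d : ℝ) - s),
      fun t h1 h2 => ?_⟩
    rw [modelBump_mid (h3.trans h1) (h2.trans h4)]
    ring

lemma modelBump_inv_affine {N s d k : ℕ} (h : s + 1 < d) (hd : d < N) (hsk : s ≤ k)
    (hkd : k ≤ d) : ∃ c e : ℝ, ∀ t : UI, (k : ℝ) / N ≤ t → (t : ℝ) ≤ ((k : ℝ) + 1) / N →
      ((modelBump N s d h hd)⁻¹ t : ℝ) = c * t + e := by
  have hD : (0 : ℝ) < (d : ℝ) - s := by linarith [one_lt_cast_sub h]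
  have hmono : ∀ {u v : UI}, modelBump N s d h hd u ≤ modelBump N s d h hd v ↔ u ≤ v :=
    (modelBump_strictMono h hd).le_iff_le
  have hs : (node N s (by omega) : ℝ) = (s : ℝ) / N := coe_node _ _ _
  have hm : (node N (s + 1) (by omega) : ℝ) = ((s : ℝ) + 1) / N := by
    rw [coe_node]; push_cast; rfl
  have he : (node N (d + 1) (by omega) : ℝ) = ((d : ℝ) + 1) / N := by
    rw [coe_node]; push_cast; rfl
  have hsk' : (s : ℝ) / N ≤ (k : ℝ) / N := by gcongr
  have hkd' : ((k : ℝ) + 1) / N ≤ ((d : ℝ) + 1) / N := by gcongr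
  have hlow : ∀ u : UI, (s : ℝ) / N ≤ modelBump N s d h hd u → (s : ℝ) / N ≤ u := by
    intro u hu
    have h0 : modelBump N s d h hd (node N s (by omega)) = node N s (by omega) :=
      modelBump_of_le hs.le
    rw [← hs] at hu ⊢
    exact hmono.1 (h0.le.trans hu)
  have hhigh : ∀ u : UI, (modelBump N s d h hd u : ℝ) ≤ ((d : ℝ) + 1) / N →
      (u : ℝ) ≤ ((d : ℝ) + 1) / N := by
    intro u hu
    have h0 : modelBump N s d h hd (node N (d + 1) (by omega)) = node N (d + 1) (by omega) :=
      modelBump_of_ge he.ge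
    rw [← he] at hu ⊢
    exact hmono.1 (le_trans hu h0.ge)
  rcases hkd.eq_or_lt with rfl | hkd
  · refine ⟨(k : ℝ) - s, ((k : ℝ) + 1) / N - ((k : ℝ) - s) * (((k : ℝ) + 1) / N),
      fun t h1 h2 => ?_⟩
    obtain ⟨u, rfl⟩ := (modelBump N s k h hd).surjective t
    rw [inv_apply_self]
    have h3 : ((s : ℝ) + 1) / N ≤ u := by
      rw [← hm]
      refine hmono.1 ((modelBump_mark h hd).le.trans ?_)
      exact h1
    rw [modelBump_mid h3 (hhigh u h2)]
    field_simp
    ring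
  · refine ⟨((d : ℝ) - s)⁻¹, (s : ℝ) / N - (s : ℝ) / N / ((d : ℝ) - s), fun t h1 h2 => ?_⟩
    obtain ⟨u, rfl⟩ := (modelBump N s d h hd).surjective t
    rw [inv_apply_self]
    have h3 : (u : ℝ) ≤ ((s : ℝ) + 1) / N := by
      rw [← hm]
      refine hmono.1 (le_trans ?_ (modelBump_mark h hd).ge)
      rw [← Subtype.coe_le_coe, coe_node]
      refine h2.trans ?_
      gcongr
      exact_mod_cast hkd
    rw [modelBump_src (hlow u (hsk'.trans h1)) h3]
    field_simp
    ring

namespace FastSystem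

variable {ι : Type*} [Fintype ι] {N : ℕ} {r : ι × Bool → Fin N} {J : Type*}

lemma model_elt_isPL (inj : Function.Injective r)
    (gap : ∀ i, (r (i, false) : ℕ) + 1 < r (i, true)) (C : Assembly r J) (j : J) :
    IsPL ((model inj gap).elt C j) := by
  rcases Nat.eq_zero_or_pos N with rfl | hN
  · refine ⟨1, fun i => (i : ℕ), fun a b hab => by simpa using hab, by simp, by simp, fun i => ?_⟩
    refine ⟨1, 0, fun s _ _ => ?_⟩
    rw [elt_of_notMem fun i => (r (i, false)).elim0]
    ring
  · have hN' : (0 : ℝ) < N := by exact_mod_cast hN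
    refine ⟨N, fun i => (i : ℕ) / (N : ℝ), fun a b hab => ?_, by simp, ?_, fun k => ?_⟩
    · simp only
      gcongr
      exact hab
    · simp [hN'.ne']
    · have hk : ∀ s : UI, ((k.castSucc : ℕ) : ℝ) / N ≤ s → (s : ℝ) ≤ ((k.succ : ℕ) : ℝ) / N →
          (model inj gap).lo k ≤ s ∧ s ≤ (model inj gap).hi k := fun s h1 h2 =>
        ⟨h1, h2⟩
      rcases elt_eqOn_Icc (S := model inj gap) (C := C) (j := j) k with h | ⟨i, h1, h2, h⟩
      · exact ⟨1, 0, fun s hs1 hs2 => by rw [h s (hk s hs1 hs2).1 (hk s hs1 hs2).2]; ring⟩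
      · obtain ⟨c, e, hce⟩ : ∃ c e : ℝ, ∀ t : UI, ((k : ℕ) : ℝ) / N ≤ t →
            (t : ℝ) ≤ (((k : ℕ) : ℝ) + 1) / N → ((model inj gap).bump C i t : ℝ) = c * t + e := by
          have h3 : (r (i, false) : ℕ) ≤ k := h1
          have h4 : (k : ℕ) ≤ r (i, true) := h2
          cases hs : C.sign i
          · rw [bump, hs]
            exact modelBump_inv_affine (gap i) (r (i, true)).2 h3 h4
          · rw [bump, hs]
            exact modelBump_affine (gap i) (r (i, true)).2 h3 h4
        refine ⟨c, e, fun s hs1 hs2 => ?_⟩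
        rw [h s (hk s hs1 hs2).1 (hk s hs1 hs2).2]
        refine hce s hs1 (hs2.trans_eq ?_)
        simp only [Fin.val_succ]
        push_cast
        rfl

end FastSystem

/-! ### The isomorphism of groups -/

/-- Two homomorphisms with the same kernel on a subgroup have isomorphic images of it. -/
theorem exists_mulEquiv_of_eq_one_iff {G K : Type*} [Group G] [Group K] (p q : G →* K)
    (H : Subgroup G) (h : ∀ w ∈ H, p w = 1 ↔ q w = 1) :
    ∃ φ : H.map p ≃* H.map q, ∀ (w : G) (hw : w ∈ H),
      (φ ⟨p w, Subgroup.mem_map_of_mem p hw⟩ : K) = q w := by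
  have hker : (p.subgroupMap H).ker = (q.subgroupMap H).ker := by
    ext w
    simp only [MonoidHom.mem_ker, Subtype.ext_iff]
    exact h w w.2
  refine ⟨(QuotientGroup.quotientKerEquivOfSurjective _ (p.subgroupMap_surjective H)).symm.trans
    ((QuotientGroup.quotientMulEquivOfEq hker).trans
      (QuotientGroup.quotientKerEquivOfSurjective _ (q.subgroupMap_surjective H))),
    fun w hw => ?_⟩
  have h1 : (QuotientGroup.quotientKerEquivOfSurjective _ (p.subgroupMap_surjective H)).symm
      ⟨p w, Subgroup.mem_map_of_mem p hw⟩ = QuotientGroup.mk (⟨w, hw⟩ : H) := by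
    rw [MulEquiv.symm_apply_eq]
    rfl
  rw [MulEquiv.trans_apply, h1]
  rfl

namespace FastSystem

variable {ι : Type*} [Fintype ι] {N : ℕ} {r : ι × Bool → Fin N} {J : Type*}

lemma closure_range_elt (S : FastSystem r) (C : Assembly r J) :
    Subgroup.closure (range (S.elt C)) = (Subgroup.closure (range C.word)).map S.rep := by
  rw [MonoidHom.map_closure, ← range_comp]
  rfl

lemma IsSemiconj.elt_injective {S T : FastSystem r} {θ : UI → UI} (h : IsSemiconj S T θ)
    (hT : T.IsTiled) {C : Assembly r J} (hS : Function.Injective (S.elt C)) :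
    Function.Injective (T.elt C) := by
  intro j k hjk
  apply hS
  have h1 := h.rep_eq_one_iff hT (C.word j * (C.word k)⁻¹)
  rw [map_mul, map_mul, map_inv, map_inv, mul_inv_eq_one, mul_inv_eq_one] at h1
  exact h1.2 hjk

/-- A semiconjugacy onto a tiled fast system induces an isomorphism of the groups generated by the
elements of an assembly. -/
theorem IsSemiconj.exists_mulEquiv {S T : FastSystem r} {θ : UI → UI} (h : IsSemiconj S T θ)
    (hT : T.IsTiled) (C : Assembly r J) :
    ∃ φ : Subgroup.closure (range (S.elt C)) ≃* Subgroup.closure (range (T.elt C)),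
      (∀ j, (φ ⟨S.elt C j, Subgroup.subset_closure ⟨j, rfl⟩⟩ : Homeo01) = T.elt C j) ∧
      ∀ (f : Subgroup.closure (range (S.elt C))) t, θ ((f : Homeo01) t) =
        (φ f : Homeo01) (θ t) := by
  obtain ⟨φ, hφ⟩ := exists_mulEquiv_of_eq_one_iff S.rep T.rep (Subgroup.closure (range C.word))
    fun w _ => h.rep_eq_one_iff hT w
  refine ⟨(MulEquiv.subgroupCongr (S.closure_range_elt C)).trans
    (φ.trans (MulEquiv.subgroupCongr (T.closure_range_elt C).symm)), fun j => ?_, ?_⟩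
  · exact hφ _ (Subgroup.subset_closure ⟨j, rfl⟩)
  · rintro ⟨f, hf⟩ t
    obtain ⟨w, hw, rfl⟩ := (S.closure_range_elt C).le hf
    exact (h.map_rep w t).trans (congrArg (· (θ t)) (hφ w hw).symm)

end FastSystem

/-- **Theorem (SemiConjThm).** For any finite geometrically fast marked set
`X₀ ⊆ Homeo₊(I)` with finitely many transition points there is a geometrically fast
`Y ⊆ PL₊(I)` with isomorphic dynamical diagram such that for every geometrically fast
`X ⊆ Homeo₊(I)` with finitely many transition points whose dynamical diagram is
isomorphic to that of `Y` via `τ : X → Y`, there are a marked isomorphism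
`φ : ⟨X⟩ → ⟨Y⟩` extending `τ` and a continuous order-preserving surjection
`θ̂ : I → I` with `(tf)θ̂ = (tθ̂)φ(f)`. -/
theorem semi_conj (X₀ : Set Homeo01) (m₀ : Homeo01 → UI)
    (hX₀ : ∀ f ∈ X₀, IsOPH f) (hX₀fin : X₀.Finite)
    (h₀prop : GeomProper X₀) (hm₀ : IsMarking (usedBumps X₀) m₀)
    (hfd₀ : FeetDisjoint (usedBumps X₀) m₀)
    (htr₀ : (transitionPoints X₀).Finite) :
    ∃ (Y : Set Homeo01) (mY : Homeo01 → UI),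
      (∀ y ∈ Y, IsOPH y ∧ IsPL y) ∧ GeomProper Y ∧
      IsMarking (usedBumps Y) mY ∧ FeetDisjoint (usedBumps Y) mY ∧
      (transitionPoints Y).Finite ∧
      (∃ τ₀ : Homeo01 → Homeo01, DiagIso X₀ m₀ Y mY τ₀) ∧
      ∀ (X : Set Homeo01) (mX : Homeo01 → UI) (τ : Homeo01 → Homeo01),
        (∀ f ∈ X, IsOPH f) → GeomProper X → IsMarking (usedBumps X) mX →
        FeetDisjoint (usedBumps X) mX → (transitionPoints X).Finite →
        DiagIso X mX Y mY τ →
        ∃ φ : Subgroup.closure X ≃* Subgroup.closure Y,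
          (∀ (f : Homeo01) (hfX : f ∈ X),
            (↑(φ ⟨f, Subgroup.subset_closure hfX⟩) : Homeo01) = τ f) ∧
          ∃ θ : UI → UI, Continuous θ ∧ Monotone θ ∧ Function.Surjective θ ∧
            ∀ (h : Homeo01) (hh : h ∈ Subgroup.closure X), ∀ t : UI,
              θ (h t) = (↑(φ ⟨h, hh⟩) : Homeo01) (θ t) := by
  obtain ⟨ι, _, N, r, C, S₀, hr, hC, hm₀S⟩ := exists_presentation hX₀ h₀prop hm₀ hfd₀ htr₀
  have hX₀C : X₀ = range (S₀.elt C) := by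
    ext f
    exact ⟨fun hf => ⟨⟨f, hf⟩, hC _⟩, fun ⟨j, hj⟩ => hj ▸ (hC j).symm ▸ j.2⟩
  have hS₀ : Function.Injective (S₀.elt C) := fun j k h =>
    Subtype.ext ((hC j).symm.trans (h.trans (hC k)))
  have hT := FastSystem.model_isTiled hr.inj hr.gap
  obtain ⟨θ₀, -, hθ₀⟩ := S₀.exists_isSemiconj_model
  have hPL := FastSystem.model_elt_isPL hr.inj hr.gap C
  set T := FastSystem.model hr.inj hr.gap
  let m : Homeo01 → UI := Function.extend T.g (fun i => T.hi (r (i, false))) fun _ => 0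
  have hm : ∀ i, m (T.g i) = T.hi (r (i, false)) := T.g_injective.extend_apply _ _
  refine ⟨range (T.elt C), m, ?_, T.geomProper_range, ?_, ?_, T.finite_transitionPoints_range,
    ?_, ?_⟩
  · rintro - ⟨j, rfl⟩
    exact ⟨T.elt_isOPH j, hPL j⟩
  · rw [FastSystem.usedBumps_range]
    exact FastSystem.isMarking_range hm
  · rw [FastSystem.usedBumps_range]
    exact FastSystem.feetDisjoint_range hm
  · obtain ⟨τ₀, h⟩ := FastSystem.exists_diagIso hm₀S hm hS₀ (hθ₀.elt_injective hT hS₀)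
    rw [← hX₀C] at h
    exact ⟨τ₀, h⟩
  · intro X mX τ hX _ hmX hfd _ h
    obtain ⟨S, rfl, hτ⟩ := FastSystem.exists_of_diagIso hr hm hX hmX hfd h
    obtain ⟨θ, hθc, hθ⟩ := S.exists_isSemiconj_model
    obtain ⟨φ, hφ, hφθ⟩ := hθ.exists_mulEquiv hT C
    refine ⟨φ, ?_, θ, hθc, hθ.mono, hθ.surj, fun f hf t => hφθ ⟨f, hf⟩ t⟩
    rintro - ⟨j, rfl⟩
    exact (hφ j).trans (hτ j).symm

end PingPong
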